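/- (Veech's weak mixing theorem.) Let m ≥ 1 and let π be an irreducible permutation of {1,...,m}. Then for Lebesgue-almost every λ in the positive orthant ℝ_+^m, the following holds for every ν ∈ ℝ^m: if there exists a measurable function f : [0,|λ|) → ℂ, nonzero on a set of positive Lebesgue measure, such that f(T_{(λ,π)} x) = φ_{(λ,ν)}(x) f(x) for Lebesgue-almost every x ∈ [0,|λ|), then b_S · ν ∈ ℤ for every orbit S ∈ Σ(π). -/

import Mathlib

open MeasureTheory Set

noncomputable section

open scoped Classical

/-- Left endpoint of the `j`-th subinterval: `∑_{i<j} λ_i`. -/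
def pre {m : ℕ} (lam : Fin m → ℝ) (j : Fin m) : ℝ :=
  ∑ i ∈ Finset.univ.filter (fun i => i < j), lam i

/-- The `j`-th subinterval `I_j^λ = [∑_{i<j} λ_i, ∑_{i≤j} λ_i)`. -/
def block {m : ℕ} (lam : Fin m → ℝ) (j : Fin m) : Set ℝ :=
  Set.Ico (pre lam j) (pre lam j + lam j)

/-- The translation vector `w_j = ∑_{i : π(i) < π(j)} λ_i − ∑_{i<j} λ_i`. -/
def wvec {m : ℕ} (lam : Fin m → ℝ) (π : Equiv.Perm (Fin m)) (j : Fin m) : ℝ :=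
  (∑ i ∈ Finset.univ.filter (fun i => π i < π j), lam i) - pre lam j

/-- The interval exchange transformation `T_{(λ,π)}`: on `I_j^λ` it is `x ↦ x + w_j`
(the subintervals `I_j^λ` are pairwise disjoint, so at most one summand is nonzero). -/
def iet {m : ℕ} (lam : Fin m → ℝ) (π : Equiv.Perm (Fin m)) (x : ℝ) : ℝ :=
  x + ∑ j : Fin m, if x ∈ block lam j then wvec lam π j else 0

/-- The multiplier `φ_{(λ,ν)}(x) = exp(2πi ν_j)` for `x ∈ I_j^λ`. -/
def phiFn {m : ℕ} (lam : Fin m → ℝ) (nu : Fin m → ℝ) (x : ℝ) : ℂ :=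
  ∏ j : Fin m,
    if x ∈ block lam j then Complex.exp (2 * Real.pi * Complex.I * (nu j : ℂ)) else 1

/-- `π` is irreducible: `π({1,…,k}) = {1,…,k}` (for `1 ≤ k ≤ m`) only for `k = m`. -/
def PermIrreducible {m : ℕ} (π : Equiv.Perm (Fin m)) : Prop :=
  ∀ k : ℕ, 1 ≤ k → k ≤ m →
    (Finset.univ.filter (fun i : Fin m => (i : ℕ) < k)).image π =
      Finset.univ.filter (fun i : Fin m => (i : ℕ) < k) →
    k = m

/-- `π` extended to `{0,1,…,m+1}` (as a map of `ℕ`) by `π(0) = 0`, `π(m+1) = m+1`. -/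
def piExt {m : ℕ} (π : Equiv.Perm (Fin m)) (i : ℕ) : ℕ :=
  if h : 1 ≤ i ∧ i ≤ m then (π ⟨i - 1, by omega⟩ : ℕ) + 1 else i

/-- The corresponding extension of `π⁻¹`. -/
def piExtInv {m : ℕ} (π : Equiv.Perm (Fin m)) (i : ℕ) : ℕ :=
  if h : 1 ≤ i ∧ i ≤ m then (π.symm ⟨i - 1, by omega⟩ : ℕ) + 1 else i

/-- The map `σ_π(i) = π⁻¹(π(i)+1) − 1`, for `0 ≤ i ≤ m`. -/
def sigmaPi {m : ℕ} (π : Equiv.Perm (Fin m)) (i : ℕ) : ℕ :=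
  piExtInv π (piExt π i + 1) - 1

/-- The orbit of `i ∈ {0,…,m}` under iteration of `σ_π`. -/
def orbitOf {m : ℕ} (π : Equiv.Perm (Fin m)) (i : ℕ) : Finset ℕ :=
  (Finset.Iic m).filter (fun j => ∃ n : ℕ, (sigmaPi π)^[n] i = j)

/-- `Σ(π)`: the set of orbits of `σ_π` on `{0,1,…,m}`. -/
def orbitsOf {m : ℕ} (π : Equiv.Perm (Fin m)) : Finset (Finset ℕ) :=
  (Finset.Iic m).image (orbitOf π)

/-- The vector `b_S ∈ ℤ^m`, `(b_S)_i = χ_S(i−1) − χ_S(i)` for `1 ≤ i ≤ m`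
(the index `i : Fin m` encodes the 1-based index `i+1`). -/
def bvec {m : ℕ} (S : Finset ℕ) (i : Fin m) : ℤ :=
  (if (i : ℕ) ∈ S then 1 else 0) - (if (i : ℕ) + 1 ∈ S then 1 else 0)

section Blocks

variable {m : ℕ} {lam : Fin m → ℝ}

lemma pre_add (a b : Fin m → ℝ) (j : Fin m) : pre (a + b) j = pre a j + pre b j := by
  simp [pre, Finset.sum_add_distrib]

lemma pre_smul (t : ℝ) (a : Fin m → ℝ) (j : Fin m) : pre (t • a) j = t * pre a j := by
  simp [pre, Finset.mul_sum]

lemma pre_nonneg (hpos : ∀ j, 0 < lam j) (j : Fin m) : 0 ≤ pre lam j :=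
  Finset.sum_nonneg fun i _ => (hpos i).le

lemma pre_add_self (lam : Fin m → ℝ) (j : Fin m) :
    pre lam j + lam j = ∑ i ∈ Finset.univ.filter (fun i => i ≤ j), lam i := by
  have : Finset.univ.filter (fun i => i ≤ j) =
      insert j (Finset.univ.filter (fun i : Fin m => i < j)) := by
    ext i; simp [le_iff_eq_or_lt]
  rw [this, Finset.sum_insert (by simp), pre, add_comm]

lemma pre_add_self_le_pre (hpos : ∀ j, 0 < lam j) {i j : Fin m} (hij : i < j) :
    pre lam i + lam i ≤ pre lam j := by
  rw [pre_add_self, pre]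
  refine Finset.sum_le_sum_of_subset_of_nonneg ?_ fun k _ _ => (hpos k).le
  intro k hk
  simp only [Finset.mem_filter, Finset.mem_univ, true_and] at hk ⊢
  exact lt_of_le_of_lt hk hij

lemma pre_add_self_le_sum (hpos : ∀ j, 0 < lam j) (j : Fin m) :
    pre lam j + lam j ≤ ∑ i, lam i := by
  rw [pre_add_self]
  exact Finset.sum_le_sum_of_subset_of_nonneg (Finset.filter_subset _ _) fun k _ _ => (hpos k).le

lemma pre_mono (hpos : ∀ j, 0 < lam j) {i j : Fin m} (hij : i ≤ j) : pre lam i ≤ pre lam j := by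
  rcases hij.eq_or_lt with rfl | h
  · exact le_rfl
  · linarith [pre_add_self_le_pre hpos h, hpos i]

lemma pre_of_val_eq_zero {j : Fin m} (hj : (j : ℕ) = 0) : pre lam j = 0 := by
  rw [pre, Finset.sum_eq_zero]
  intro i hi
  simp only [Finset.mem_filter, Finset.mem_univ, true_and, Fin.lt_def] at hi
  omega

lemma pre_of_val_eq_succ {i j : Fin m} (hij : (j : ℕ) = i + 1) :
    pre lam j = pre lam i + lam i := by
  rw [pre_add_self, pre]
  congr 1
  ext k
  simp only [Finset.mem_filter, Finset.mem_univ, true_and, Fin.lt_def, Fin.le_def]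
  omega

lemma pre_add_self_eq_sum {j : Fin m} (hj : (j : ℕ) + 1 = m) :
    pre lam j + lam j = ∑ i, lam i := by
  rw [pre_add_self]
  congr 1
  ext k
  simp only [Finset.mem_filter, Finset.mem_univ, true_and, Fin.le_def, iff_true]
  omega

/-- The right endpoint of a block is the left endpoint of another one, or the end of the
whole interval. -/
lemma pre_add_self_eq_or (lam : Fin m → ℝ) (j : Fin m) :
    pre lam j + lam j = ∑ i, lam i ∨ ∃ k : Fin m, 0 < (k : ℕ) ∧ pre lam j + lam j = pre lam k := by
  by_cases h : (j : ℕ) + 1 = m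
  · exact Or.inl (pre_add_self_eq_sum h)
  · have := j.isLt
    exact Or.inr ⟨⟨j + 1, by omega⟩, by simp, (pre_of_val_eq_succ rfl).symm⟩

lemma exists_mem_block {x : ℝ} (hx : x ∈ Ico 0 (∑ i, lam i)) : ∃ j, x ∈ block lam j := by
  have hm : 0 < m := by
    rcases Nat.eq_zero_or_pos m with rfl | h
    · simp at hx
    · exact h
  have hne : (Finset.univ.filter (fun j => pre lam j ≤ x)).Nonempty :=
    ⟨⟨0, hm⟩, by simp [pre_of_val_eq_zero, hx.1]⟩
  obtain ⟨j, hj, hmax⟩ := Finset.exists_max_image _ (fun j : Fin m => (j : ℕ)) hne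
  simp only [Finset.mem_filter, Finset.mem_univ, true_and] at hj hmax
  refine ⟨j, hj, ?_⟩
  by_contra! hlt
  by_cases h : (j : ℕ) + 1 = m
  · rw [pre_add_self_eq_sum h] at hlt
    exact absurd hx.2 (not_lt.2 hlt)
  · have hjl := j.isLt
    have := hmax ⟨j + 1, by omega⟩ (by rw [pre_of_val_eq_succ (i := j) rfl]; exact hlt)
    simp at this

lemma block_subset (hpos : ∀ j, 0 < lam j) (j : Fin m) : block lam j ⊆ Ico 0 (∑ i, lam i) :=
  fun _ hx => ⟨(pre_nonneg hpos j).trans hx.1, hx.2.trans_le (pre_add_self_le_sum hpos j)⟩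

lemma lt_of_mem_block (hpos : ∀ j, 0 < lam j) {x y : ℝ} {i j : Fin m} (hx : x ∈ block lam i)
    (hy : y ∈ block lam j) (hij : i < j) : x < y :=
  hx.2.trans_le ((pre_add_self_le_pre hpos hij).trans hy.1)

lemma block_unique (hpos : ∀ j, 0 < lam j) {x : ℝ} {i j : Fin m} (hi : x ∈ block lam i)
    (hj : x ∈ block lam j) : i = j := by
  rcases lt_trichotomy i j with h | h | h
  · exact absurd (lt_of_mem_block hpos hi hj h) (lt_irrefl _)
  · exact h
  · exact absurd (lt_of_mem_block hpos hj hi h) (lt_irrefl _)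

lemma pre_mem_block (hpos : ∀ j, 0 < lam j) (j : Fin m) : pre lam j ∈ block lam j :=
  ⟨le_rfl, by linarith [hpos j]⟩

lemma pre_mem_Ico (hpos : ∀ j, 0 < lam j) (j : Fin m) : pre lam j ∈ Ico 0 (∑ i, lam i) :=
  block_subset hpos j (pre_mem_block hpos j)

/-- Two points with no left endpoint of a block separating them lie in the same block. -/
lemma mem_block_of_le {x y : ℝ} {j : Fin m} (hx : x ∈ block lam j)
    (hxy : x ≤ y) (hy : y < ∑ i, lam i)
    (h : ∀ k : Fin m, 0 < (k : ℕ) → pre lam k ∉ Ioc x y) : y ∈ block lam j := by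
  refine ⟨hx.1.trans hxy, ?_⟩
  rcases pre_add_self_eq_or lam j with h' | ⟨k, hk, h'⟩
  · rwa [h']
  · by_contra! hlt
    exact h k hk ⟨h' ▸ hx.2, h' ▸ hlt⟩

/-- A right-open window meeting no left endpoint in its interior lies in one block. -/
lemma window_le_of_mem_block {x e : ℝ} {j : Fin m}
    (hx : x ∈ block lam j) (hxe : x + e ≤ ∑ i, lam i)
    (h : ∀ k : Fin m, 0 < (k : ℕ) → pre lam k ∉ Ioo x (x + e)) :
    x + e ≤ pre lam j + lam j := by
  rcases pre_add_self_eq_or lam j with h' | ⟨k, hk, h'⟩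
  · rwa [h']
  · by_contra! hlt
    exact h k hk ⟨h' ▸ hx.2, h' ▸ hlt⟩

end Blocks

section Exchange

variable {m : ℕ} {lam : Fin m → ℝ} {π : Equiv.Perm (Fin m)}

/-- The lengths of the exchanged intervals, in their order after the exchange. -/
def permLam (lam : Fin m → ℝ) (π : Equiv.Perm (Fin m)) : Fin m → ℝ := lam ∘ π.symm

lemma permLam_apply (lam : Fin m → ℝ) (π : Equiv.Perm (Fin m)) (j : Fin m) :
    permLam lam π (π j) = lam j := by simp [permLam]

lemma permLam_pos (hpos : ∀ j, 0 < lam j) (j : Fin m) : 0 < permLam lam π j := hpos _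

lemma sum_permLam (lam : Fin m → ℝ) (π : Equiv.Perm (Fin m)) :
    ∑ i, permLam lam π i = ∑ i, lam i := Equiv.sum_comp π.symm lam

lemma pre_permLam (lam : Fin m → ℝ) (π : Equiv.Perm (Fin m)) (j : Fin m) :
    pre (permLam lam π) (π j) = pre lam j + wvec lam π j := by
  rw [wvec, add_sub_cancel, pre, permLam]
  refine Finset.sum_equiv π.symm ?_ ?_
  · intro i; simp
  · intro i _; rfl

lemma wvec_add (a b : Fin m → ℝ) (π : Equiv.Perm (Fin m)) (j : Fin m) :
    wvec (a + b) π j = wvec a π j + wvec b π j := by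
  simp only [wvec, pre_add, Pi.add_apply, Finset.sum_add_distrib]; ring

lemma wvec_smul (t : ℝ) (a : Fin m → ℝ) (π : Equiv.Perm (Fin m)) (j : Fin m) :
    wvec (t • a) π j = t * wvec a π j := by
  simp only [wvec, pre_smul, Pi.smul_apply, smul_eq_mul, ← Finset.mul_sum]; ring

lemma iet_of_mem (hpos : ∀ j, 0 < lam j) {x : ℝ} {j : Fin m} (hx : x ∈ block lam j) :
    iet lam π x = x + wvec lam π j := by
  rw [iet, Finset.sum_eq_single j]
  · simp [hx]
  · intro i _ hi
    rw [if_neg]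
    exact fun h => hi (block_unique hpos h hx)
  · simp

lemma phiFn_of_mem (hpos : ∀ j, 0 < lam j) {nu : Fin m → ℝ} {x : ℝ} {j : Fin m}
    (hx : x ∈ block lam j) :
    phiFn lam nu x = Complex.exp (2 * Real.pi * Complex.I * (nu j : ℂ)) := by
  rw [phiFn, Finset.prod_eq_single j]
  · simp [hx]
  · intro i _ hi
    rw [if_neg]
    exact fun h => hi (block_unique hpos h hx)
  · simp

lemma iet_mem_block (hpos : ∀ j, 0 < lam j) {x : ℝ} {j : Fin m} (hx : x ∈ block lam j) :
    iet lam π x ∈ block (permLam lam π) (π j) := by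
  rw [iet_of_mem hpos hx, block, pre_permLam, permLam_apply]
  constructor <;> linarith [hx.1, hx.2]

lemma iet_mem_Ico (hpos : ∀ j, 0 < lam j) {x : ℝ} (hx : x ∈ Ico 0 (∑ i, lam i)) :
    iet lam π x ∈ Ico 0 (∑ i, lam i) := by
  obtain ⟨j, hj⟩ := exists_mem_block hx
  have := block_subset (permLam_pos hpos) _ (iet_mem_block (π := π) hpos hj)
  rwa [sum_permLam] at this

lemma iterate_iet_mem_Ico (hpos : ∀ j, 0 < lam j) {x : ℝ} (hx : x ∈ Ico 0 (∑ i, lam i)) (n : ℕ) :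
    (iet lam π)^[n] x ∈ Ico 0 (∑ i, lam i) := by
  induction n with
  | zero => exact hx
  | succ n ih => rw [Function.iterate_succ_apply']; exact iet_mem_Ico hpos ih

lemma iet_injOn (hpos : ∀ j, 0 < lam j) : InjOn (iet lam π) (Ico 0 (∑ i, lam i)) := by
  intro x hx y hy hxy
  obtain ⟨i, hi⟩ := exists_mem_block hx
  obtain ⟨j, hj⟩ := exists_mem_block hy
  have h1 := iet_mem_block (π := π) hpos hi
  have h2 := iet_mem_block (π := π) hpos hj
  rw [hxy] at h1
  have := π.injective (block_unique (permLam_pos hpos) h1 h2)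
  subst this
  rw [iet_of_mem hpos hi, iet_of_mem hpos hj] at hxy
  linarith

lemma iet_pre (hpos : ∀ j, 0 < lam j) (j : Fin m) :
    iet lam π (pre lam j) = pre (permLam lam π) (π j) := by
  rw [iet_of_mem hpos (pre_mem_block hpos j), pre_permLam]

/-- A window meeting no image of a left endpoint in its interior is the translate under `iet`
of a window contained in one block. -/
lemma exists_preimage_window (hpos : ∀ j, 0 < lam j) {x e : ℝ} (he : 0 < e) (hx : 0 ≤ x)
    (hxe : x + e ≤ ∑ i, lam i)
    (h : ∀ s : Fin m, iet lam π (pre lam s) ∉ Ioo x (x + e)) :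
    ∃ (y : ℝ) (j : Fin m), y ∈ block lam j ∧ y + e ≤ pre lam j + lam j ∧ iet lam π y = x := by
  obtain ⟨k, hk⟩ := exists_mem_block (lam := permLam lam π) (x := x)
    ⟨hx, by rw [sum_permLam]; linarith⟩
  obtain ⟨j, rfl⟩ := π.surjective k
  have h1 : x + e ≤ pre (permLam lam π) (π j) + permLam lam π (π j) := by
    refine window_le_of_mem_block hk (by rwa [sum_permLam]) fun k _ => ?_
    obtain ⟨s, rfl⟩ := π.surjective k
    rw [← iet_pre hpos]
    exact h s
  rw [block, pre_permLam, permLam_apply] at hk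
  rw [pre_permLam, permLam_apply] at h1
  have hy : x - wvec lam π j ∈ block lam j := ⟨by linarith [hk.1], by linarith [hk.2]⟩
  refine ⟨x - wvec lam π j, j, hy, by linarith, ?_⟩
  rw [iet_of_mem hpos hy]; ring

end Exchange

section Measure

variable {m : ℕ} {lam : Fin m → ℝ} {π : Equiv.Perm (Fin m)}

lemma measurableSet_block (lam : Fin m → ℝ) (j : Fin m) : MeasurableSet (block lam j) :=
  measurableSet_Ico

lemma measurable_iet (lam : Fin m → ℝ) (π : Equiv.Perm (Fin m)) : Measurable (iet lam π) := by
  unfold iet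
  refine measurable_id.add (Finset.measurable_sum _ fun j _ => ?_)
  exact Measurable.ite (measurableSet_block lam j) measurable_const measurable_const

lemma iUnion_block (hpos : ∀ j, 0 < lam j) : ⋃ j, block lam j = Ico 0 (∑ i, lam i) := by
  ext x
  simp only [mem_iUnion]
  exact ⟨fun ⟨j, hj⟩ => block_subset hpos j hj, exists_mem_block⟩

lemma volume_inter_Ico_eq_sum (hpos : ∀ j, 0 < lam j) {A : Set ℝ} (hA : MeasurableSet A) :
    volume (A ∩ Ico 0 (∑ i, lam i)) = ∑ j, volume (A ∩ block lam j) := by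
  rw [← iUnion_block hpos, inter_iUnion, measure_iUnion, tsum_fintype]
  · intro i j hij
    refine Set.disjoint_left.2 fun x hx hx' => hij (block_unique hpos hx.2 hx'.2)
  · exact fun j => hA.inter (measurableSet_block lam j)

lemma measurePreserving_iet (hpos : ∀ j, 0 < lam j) :
    MeasurePreserving (iet lam π) (volume.restrict (Ico 0 (∑ i, lam i)))
      (volume.restrict (Ico 0 (∑ i, lam i))) := by
  refine ⟨measurable_iet lam π, ?_⟩
  ext A hA
  rw [Measure.map_apply (measurable_iet lam π) hA, Measure.restrict_apply hA,
    Measure.restrict_apply (measurable_iet lam π hA),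
    volume_inter_Ico_eq_sum hpos (measurable_iet lam π hA)]
  conv_rhs => rw [← sum_permLam lam π, volume_inter_Ico_eq_sum (permLam_pos hpos) hA,
    ← Equiv.sum_comp π]
  refine Finset.sum_congr rfl fun j _ => ?_
  have : iet lam π ⁻¹' A ∩ block lam j =
      (fun x => x + wvec lam π j) ⁻¹' (A ∩ block (permLam lam π) (π j)) := by
    ext x
    simp only [mem_inter_iff, mem_preimage]
    have hiff : x + wvec lam π j ∈ block (permLam lam π) (π j) ↔ x ∈ block lam j := by
      rw [block, pre_permLam, permLam_apply, block, mem_Ico, mem_Ico]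
      constructor <;> rintro ⟨h1, h2⟩ <;> constructor <;> linarith
    rw [hiff]
    refine and_congr_left fun hx => ?_
    rw [iet_of_mem hpos hx]
  rw [this, measure_preimage_add_right]

/-- Every right neighbourhood of a point returns to itself under the exchange. -/
lemma exists_return (hpos : ∀ j, 0 < lam j) {a b : ℝ} (ha : 0 ≤ a) (hab : a < b)
    (hb : b ≤ ∑ i, lam i) :
    ∃ x ∈ Ico a b, ∃ n, 0 < n ∧ (iet lam π)^[n] x ∈ Ico a b := by
  have : IsFiniteMeasure (volume.restrict (Ico 0 (∑ i, lam i)) : Measure ℝ) :=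
    ⟨by simp [Real.volume_Ico]⟩
  have hc := (measurePreserving_iet (π := π) hpos).conservative
  have hs : (volume.restrict (Ico 0 (∑ i, lam i))) (Ico a b) ≠ 0 := by
    rw [Measure.restrict_apply measurableSet_Ico,
      inter_eq_left.2 (Ico_subset_Ico ha hb), Real.volume_Ico]
    simpa using hab
  obtain ⟨x, hx, n, hn, hx'⟩ := hc.exists_mem_iterate_mem measurableSet_Ico.nullMeasurableSet hs
  exact ⟨x, hx, n, Nat.pos_of_ne_zero hn, hx'⟩

end Measure

section Cycle

/-- A closed walk can be shortened to one whose vertices are distinct, keeping its base point. -/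
lemma exists_simple_closed_walk {α : Type*} (R : α → α → Prop) (a : α)
    (h : ∃ n, 0 < n ∧ ∃ w : ℕ → α, w 0 = a ∧ w n = a ∧ ∀ i < n, R (w i) (w (i + 1))) :
    ∃ n, 0 < n ∧ ∃ w : ℕ → α, w 0 = a ∧ w n = a ∧ (∀ i < n, R (w i) (w (i + 1))) ∧
      InjOn w (Iio n) := by
  obtain ⟨hn, w, h0, hend, hw⟩ := Nat.find_spec h
  have hmin := fun k => Nat.find_min h (m := k)
  set n := Nat.find h
  refine ⟨n, hn, w, h0, hend, hw, ?_⟩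
  by_contra hinj
  obtain ⟨i, j, hij, hj, he⟩ : ∃ i j, i < j ∧ j < n ∧ w i = w j := by
    simp only [InjOn, not_forall] at hinj
    obtain ⟨i, hi, j, hj, he, hne⟩ := hinj
    rcases Nat.lt_or_gt_of_ne hne with hlt | hlt
    · exact ⟨i, j, hlt, hj, he⟩
    · exact ⟨j, i, hlt, hi, he.symm⟩
  refine hmin (n - (j - i)) (by omega) ⟨by omega,
    fun k => if k ≤ i then w k else w (k + (j - i)), by simp [h0], ?_, ?_⟩
  · have h1 : ¬ n - (j - i) ≤ i := by omega
    simp only [h1, if_false]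
    rw [Nat.sub_add_cancel (by omega), hend]
  · intro k hk
    rcases lt_trichotomy k i with hki | rfl | hki
    · have h1 : k + 1 ≤ i := hki
      simp only [hki.le, h1, if_true]
      exact hw k (by omega)
    · have h1 : ¬ k + 1 ≤ k := by omega
      simp only [le_refl, h1, if_true, if_false, he]
      have := hw j hj
      rwa [show k + 1 + (j - k) = j + 1 by omega]
    · have h1 : ¬ k + 1 ≤ i := by omega
      have h2 : ¬ k ≤ i := by omega
      simp only [h1, h2, if_false]
      have := hw (k + (j - i)) (by omega)
      rwa [show k + 1 + (j - i) = k + (j - i) + 1 by omega]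

end Cycle

section Flow

variable {m : ℕ} {lam : Fin m → ℝ} {π : Equiv.Perm (Fin m)}

/-- The `k`-th point on the orbit of the left endpoint of the `s`-th block. -/
def orbPt (lam : Fin m → ℝ) (π : Equiv.Perm (Fin m)) (s : Fin m) (k : ℕ) : ℝ :=
  (iet lam π)^[k] (pre lam s)

lemma orbPt_zero (lam : Fin m → ℝ) (π : Equiv.Perm (Fin m)) (s : Fin m) :
    orbPt lam π s 0 = pre lam s := rfl

lemma orbPt_succ (lam : Fin m → ℝ) (π : Equiv.Perm (Fin m)) (s : Fin m) (k : ℕ) :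
    orbPt lam π s (k + 1) = iet lam π (orbPt lam π s k) := Function.iterate_succ_apply' _ _ _

lemma orbPt_mem (hpos : ∀ j, 0 < lam j) (s : Fin m) (k : ℕ) :
    orbPt lam π s k ∈ Ico 0 (∑ i, lam i) :=
  iterate_iet_mem_Ico hpos (pre_mem_Ico hpos s) k

lemma sum_filter_mem_block (hpos : ∀ j, 0 < lam j) (Q : Fin m → Prop) [DecidablePred Q]
    {x : ℝ} {j : Fin m}
    (hx : x ∈ block lam j) :
    ∑ i ∈ Finset.univ.filter Q, (if x ∈ block lam i then (1 : ℝ) else 0) =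
      if Q j then 1 else 0 := by
  rw [Finset.sum_filter, Finset.sum_eq_single j]
  · simp [hx]
  · intro i _ hi
    have : x ∉ block lam i := fun h => hi (block_unique hpos h hx)
    simp [this]
  · simp

/-- How the number of points to the left changes under the exchange. -/
lemma ite_iet_lt_iet (hpos : ∀ j, 0 < lam j) {x y : ℝ} {i j : Fin m}
    (hx : x ∈ block lam i) (hy : y ∈ block lam j) :
    (if iet lam π x < iet lam π y then (1 : ℝ) else 0) =
      (if x < y then 1 else 0) +
        ((if π i < π j then 1 else 0) - (if i < j then 1 else 0)) := by
  have hx' := iet_mem_block (π := π) hpos hx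
  have hy' := iet_mem_block (π := π) hpos hy
  have h1 : i = j → (iet lam π x < iet lam π y ↔ x < y) := by
    rintro rfl
    rw [iet_of_mem hpos hx, iet_of_mem hpos hy, add_lt_add_iff_right]
  have h2 : i ≠ j → (x < y ↔ i < j) := fun hne =>
    ⟨fun h => (lt_or_gt_of_ne hne).resolve_right
      fun h' => (lt_of_mem_block hpos hy hx h').not_gt h,
      lt_of_mem_block hpos hx hy⟩
  have h3 : i ≠ j → (iet lam π x < iet lam π y ↔ π i < π j) := fun hne =>
    ⟨fun h => (lt_or_gt_of_ne (π.injective.ne hne)).resolve_right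
      fun h' => (lt_of_mem_block (permLam_pos hpos) hy' hx' h').not_gt h,
      lt_of_mem_block (permLam_pos hpos) hx' hy'⟩
  by_cases hij : i = j
  · simp only [h1 hij]
    subst hij
    simp
  · simp only [h2 hij, h3 hij]
    ring

/-- For every point `x₀` there is a degenerate length vector, given by the visits of a closed
pseudo-orbit through `x₀`, which respects the order of the first `N` points on the orbits of the
left endpoints and separates those to the left of `x₀` from those to the right. -/
lemma exists_separating_vector (hpos : ∀ j, 0 < lam j) (N : ℕ) {x₀ : ℝ}
    (hx₀ : x₀ ∈ Ico 0 (∑ i, lam i)) :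
    ∃ v : Fin m → ℝ, (∀ j, 0 ≤ v j) ∧ ∑ j, v j ≤ m * (N + 1) + 1 ∧
      ∃ F : ℝ → ℝ, Monotone F ∧ (∀ j, F (pre lam j) = pre v j) ∧
        (∀ j, F (pre lam j + lam j) = pre v j + v j) ∧
        (∀ s k j, k < N → orbPt lam π s k ∈ block lam j →
          F (orbPt lam π s (k + 1)) = F (orbPt lam π s k) + wvec v π j) ∧
        ∀ s k s' k', k ≤ N → k' ≤ N → orbPt lam π s k ≤ x₀ → x₀ < orbPt lam π s' k' →
          F (orbPt lam π s k) + 1 ≤ F (orbPt lam π s' k') := by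
  set cl : ℝ → ℕ := fun x =>
    (Finset.univ.filter fun p : Fin m × Fin (N + 1) => orbPt lam π p.1 p.2 ≤ x).card with hcl_def
  have hcl_mono : ∀ x y, x ≤ y → cl x = cl y → ∀ p : Fin m × Fin (N + 1),
      orbPt lam π p.1 p.2 ≤ x ↔ orbPt lam π p.1 p.2 ≤ y := by
    intro x y hxy he p
    have hsub : (Finset.univ.filter fun p : Fin m × Fin (N + 1) => orbPt lam π p.1 p.2 ≤ x) ⊆
        Finset.univ.filter fun p : Fin m × Fin (N + 1) => orbPt lam π p.1 p.2 ≤ y := by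
      intro q hq
      simp only [Finset.mem_filter, Finset.mem_univ, true_and] at hq ⊢
      exact hq.trans hxy
    have := Finset.eq_of_subset_of_card_le hsub he.ge
    have := Finset.ext_iff.1 this p
    simpa using this
  have hcl : ∀ x y, cl x = cl y → ∀ s k, k ≤ N →
      (orbPt lam π s k ≤ x ↔ orbPt lam π s k ≤ y) := by
    intro x y he s k hk
    rcases le_total x y with h | h
    · exact hcl_mono x y h he (s, ⟨k, by omega⟩)
    · exact (hcl_mono y x h he.symm (s, ⟨k, by omega⟩)).symm
  have hcl_le : ∀ x, cl x ≤ m * (N + 1) := fun x =>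
    (Finset.card_le_univ _).trans (by simp)
  obtain ⟨b, hb0, hbL, hb⟩ : ∃ b, x₀ < b ∧ b ≤ ∑ i, lam i ∧
      ∀ p : Fin m × Fin (N + 1), orbPt lam π p.1 p.2 ≤ x₀ ∨ b ≤ orbPt lam π p.1 p.2 := by
    have h1 : ∀ᶠ b in nhdsWithin x₀ (Ioi x₀),
        ∀ p : Fin m × Fin (N + 1), orbPt lam π p.1 p.2 ≤ x₀ ∨ b ≤ orbPt lam π p.1 p.2 := by
      rw [Filter.eventually_all]
      intro p
      rcases le_or_gt (orbPt lam π p.1 p.2) x₀ with h | h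
      · exact Filter.Eventually.of_forall fun _ => Or.inl h
      · filter_upwards [Ioc_mem_nhdsGT h] with b hb using Or.inr hb.2
    obtain ⟨b, hb, hb'⟩ := (h1.and (Ioc_mem_nhdsGT hx₀.2)).exists
    exact ⟨b, hb'.1, hb'.2, hb⟩
  have hcl_b : ∀ x ∈ Ico x₀ b, cl x = cl x₀ := by
    intro x hx
    simp only [hcl_def]
    congr 1
    ext p
    simp only [Finset.mem_filter, Finset.mem_univ, true_and]
    refine ⟨fun h => (hb p).resolve_right fun h' => ?_, fun h => h.trans hx.1⟩
    exact absurd (h'.trans h) (not_le.2 hx.2)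
  obtain ⟨n, hn, w, hw0, hwn, hw, hinj⟩ := exists_simple_closed_walk
    (fun a c => ∃ x ∈ Ico 0 (∑ i, lam i), cl x = a ∧ cl (iet lam π x) = c) (cl x₀) (by
      obtain ⟨x, hx, n, hn, hx'⟩ := exists_return (π := π) hpos hx₀.1 hb0 hbL
      refine ⟨n, hn, fun i => cl ((iet lam π)^[i] x), hcl_b x hx, hcl_b _ hx', fun i _ => ?_⟩
      refine ⟨(iet lam π)^[i] x, ?_, rfl, ?_⟩
      · exact iterate_iet_mem_Ico hpos ⟨hx₀.1.trans hx.1, hx.2.trans_le hbL⟩ i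
      · simp only [Function.iterate_succ_apply'])
  have hn_le : n ≤ m * (N + 1) + 1 := by
    have : (Finset.range n).card ≤ (Finset.range (m * (N + 1) + 1)).card := by
      refine Finset.card_le_card_of_injOn w (fun i hi => ?_) (fun i hi j hj h => ?_)
      · have hi : i < n := by simpa using hi
        obtain ⟨x, -, hx, -⟩ := hw i hi
        have := hcl_le x
        simp only [Finset.coe_range, mem_Iio]
        omega
      · exact hinj (by simpa using hi) (by simpa using hj) h
    simpa using this
  choose! X hX hXw hXw' using hw
  have : Nonempty (Fin m) := ⟨(exists_mem_block (hX 0 hn)).choose⟩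
  choose! J hJ using fun i hi => exists_mem_block (hX i hi)
  set F : ℝ → ℝ := fun y => ∑ i ∈ Finset.range n, if X i < y then 1 else 0 with hF
  set v : Fin m → ℝ := fun j => ∑ i ∈ Finset.range n, if X i ∈ block lam j then 1 else 0 with hv
  have hsum : ∀ (Q : Fin m → Prop) [DecidablePred Q], ∑ j ∈ Finset.univ.filter Q, v j =
      ∑ i ∈ Finset.range n, if Q (J i) then 1 else 0 := by
    intro Q _
    simp only [hv]
    rw [Finset.sum_comm]
    refine Finset.sum_congr rfl fun i hi => ?_
    exact sum_filter_mem_block hpos Q (hJ i (Finset.mem_range.1 hi))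
  have hpre : ∀ j, F (pre lam j) = pre v j := by
    intro j
    rw [show pre v j = ∑ i ∈ Finset.univ.filter (fun i => i < j), v i from rfl, hsum]
    refine Finset.sum_congr rfl fun i hi => if_congr ?_ rfl rfl
    have hi := hJ i (Finset.mem_range.1 hi)
    refine ⟨fun h => ?_, fun h => lt_of_mem_block hpos hi (pre_mem_block hpos j) h⟩
    by_contra! h'
    exact absurd ((pre_mono hpos h').trans hi.1) (not_le.2 h)
  have hpre' : ∀ j, F (pre lam j + lam j) = pre v j + v j := by
    intro j
    rw [pre_add_self v, hsum]
    refine Finset.sum_congr rfl fun i hi => if_congr ?_ rfl rfl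
    have hi := hJ i (Finset.mem_range.1 hi)
    refine ⟨fun h => ?_, fun h => ?_⟩
    · by_contra! h'
      exact absurd ((pre_add_self_le_pre hpos h').trans hi.1) (not_le.2 h)
    · rcases h.eq_or_lt with h | h
      · rw [← h]; exact hi.2
      · exact hi.2.trans_le ((pre_add_self_le_pre hpos h).trans (by linarith [hpos j]))
  have hmono : Monotone F := by
    intro y z hyz
    refine Finset.sum_le_sum fun i _ => ?_
    by_cases h : X i < y
    · simp [h, h.trans_le hyz]
    · simp only [h, if_false]; split_ifs <;> norm_num
  refine ⟨v, fun j => Finset.sum_nonneg fun i _ => by split_ifs <;> norm_num, ?_, F, hmono, hpre,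
    hpre', ?_, ?_⟩
  · have := hsum (fun _ => True)
    simp only [Finset.filter_true, if_true, Finset.sum_const, Finset.card_range, nsmul_eq_mul,
      mul_one] at this
    rw [this]
    exact_mod_cast hn_le
  · intro s k j hk hj
    set P := orbPt lam π s (k + 1) with hP
    have hG : ∀ x y, cl x = cl y → (x < P ↔ y < P) := by
      intro x y h
      rw [← not_le, ← not_le, hcl x y h s (k + 1) hk]
    set G : ℕ → ℝ := fun c => if ∃ x, cl x = c ∧ x < P then 1 else 0 with hG_def
    have hGx : ∀ x, G (cl x) = if x < P then 1 else 0 := fun x =>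
      if_congr ⟨fun ⟨y, hy, hyP⟩ => (hG y x hy).1 hyP, fun h => ⟨x, rfl, h⟩⟩ rfl rfl
    have hcyc : ∑ i ∈ Finset.range n, G (w i) = ∑ i ∈ Finset.range n, G (w (i + 1)) := by
      have h1 := Finset.sum_range_succ (fun i => G (w i)) n
      have h2 := Finset.sum_range_succ' (fun i => G (w i)) n
      simp only [hw0, hwn] at h1 h2
      linarith
    have h1 : F P = ∑ i ∈ Finset.range n,
        if iet lam π (X i) < iet lam π (orbPt lam π s k) then (1 : ℝ) else 0 := by
      rw [← orbPt_succ, ← hP]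
      calc F P = ∑ i ∈ Finset.range n, G (w i) := Finset.sum_congr rfl fun i hi => by
            rw [← hXw i (Finset.mem_range.1 hi), hGx]
        _ = ∑ i ∈ Finset.range n, G (w (i + 1)) := hcyc
        _ = _ := Finset.sum_congr rfl fun i hi => by
            rw [← hXw' i (Finset.mem_range.1 hi), hGx]
    rw [h1, wvec, show pre v j = ∑ i ∈ Finset.univ.filter (fun i => i < j), v i from rfl, hsum, hsum,
      ← Finset.sum_sub_distrib]
    simp only [hF]
    rw [← Finset.sum_add_distrib]
    exact Finset.sum_congr rfl fun i hi =>
      ite_iet_lt_iet hpos (hJ i (Finset.mem_range.1 hi)) hj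
  · intro s k s' k' hk hk' hy hz
    have hX0 : cl (X 0) = cl x₀ := (hXw 0 hn).trans hw0
    have hy' := (hcl _ _ hX0 s k hk).2 hy
    have hz' := not_le.1 ((hcl _ _ hX0 s' k' hk').not.2 (not_le.2 hz))
    have h1 : ∑ i ∈ Finset.range n, (if i = 0 then (1 : ℝ) else 0) = 1 := by
      rw [Finset.sum_ite_eq' (Finset.range n) 0, if_pos (Finset.mem_range.2 hn)]
    rw [← h1]
    simp only [hF]
    rw [← Finset.sum_add_distrib]
    refine Finset.sum_le_sum fun i _ => ?_
    by_cases hi : i = 0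
    · subst hi
      simp [not_lt.2 hy', hz']
    · simp only [hi, if_false, add_zero]
      by_cases h : X i < orbPt lam π s k
      · simp [h, h.trans (hy.trans_lt hz)]
      · simp only [h, if_false]; split_ifs <;> norm_num

end Flow

section Cells

variable {m : ℕ} {π : Equiv.Perm (Fin m)}

/-- The itineraries and the relative order of the first points on the orbits of left endpoints. -/
def code (π : Equiv.Perm (Fin m)) (N : ℕ) (lam : Fin m → ℝ) :
    Set ((Fin m × Fin (N + 1)) × Fin m) × Set ((Fin m × Fin (N + 1)) × (Fin m × Fin (N + 1))) :=
  ({q | orbPt lam π q.1.1 q.1.2 ∈ block lam q.2},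
    {q | orbPt lam π q.1.1 q.1.2 ≤ orbPt lam π q.2.1 q.2.2})

lemma code_eq_iff {N : ℕ} {a b : Fin m → ℝ} : code π N a = code π N b ↔
    (∀ s k j, k ≤ N → (orbPt a π s k ∈ block a j ↔ orbPt b π s k ∈ block b j)) ∧
    ∀ s k s' k', k ≤ N → k' ≤ N →
      (orbPt a π s k ≤ orbPt a π s' k' ↔ orbPt b π s k ≤ orbPt b π s' k') := by
  simp only [code, Prod.mk.injEq, Set.ext_iff, mem_ofPred_eq, Prod.forall]
  refine and_congr ⟨fun h s k j hk => h s ⟨k, by omega⟩ j, fun h s k j => h s k j (by omega)⟩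
    ⟨fun h s k s' k' hk hk' => h s ⟨k, by omega⟩ s' ⟨k', by omega⟩,
      fun h s k s' k' => h s k s' k' (by omega) (by omega)⟩

/-- Translating a cell of equal codes along a separating vector. -/
lemma exists_cell_shift {b : Fin m → ℝ} (hb : ∀ j, 0 < b j) (N : ℕ) {x₀ : ℝ}
    (hx₀ : x₀ ∈ Ico 0 (∑ i, b i)) :
    ∃ v : Fin m → ℝ, (∀ j, 0 ≤ v j) ∧ ∑ j, v j ≤ m * (N + 1) + 1 ∧
      ∀ a : Fin m → ℝ, (∀ j, 0 < a j) → code π N a = code π N b → ∀ t : ℝ, 0 ≤ t →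
        code π N (a + t • v) = code π N b ∧
        ∀ s k s' k', k ≤ N → k' ≤ N → orbPt b π s k ≤ x₀ → x₀ < orbPt b π s' k' →
          orbPt (a + t • v) π s k + t ≤ orbPt (a + t • v) π s' k' := by
  obtain ⟨v, hv0, hv, F, hF, hFl, hFr, hFs, hsep⟩ := exists_separating_vector (π := π) hb N hx₀
  refine ⟨v, hv0, hv, fun a ha hab t ht => ?_⟩
  rw [code_eq_iff] at hab
  obtain ⟨hit, hord⟩ := hab
  have hpos : ∀ j, 0 < (a + t • v) j := fun j => by
    have := mul_nonneg ht (hv0 j)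
    simpa using add_pos_of_pos_of_nonneg (ha j) this
  have hmem : ∀ s k j, k ≤ N → orbPt a π s k ∈ block a j →
      orbPt (a + t • v) π s k = orbPt a π s k + t * F (orbPt b π s k) →
      orbPt (a + t • v) π s k ∈ block (a + t • v) j := by
    intro s k j hk hj he
    have hj' := (hit s k j hk).1 hj
    have h1 := hF hj'.1
    have h2 := hF hj'.2.le
    rw [hFl] at h1
    rw [hFr] at h2
    have h3 := mul_le_mul_of_nonneg_left h1 ht
    have h4 := mul_le_mul_of_nonneg_left h2 ht
    rw [he, block, pre_add, pre_smul]
    have h5 := hj.1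
    have h6 := hj.2
    simp only [mem_Ico, Pi.add_apply, Pi.smul_apply, smul_eq_mul]
    constructor <;> linarith
  have key : ∀ k, k ≤ N → ∀ s,
      orbPt (a + t • v) π s k = orbPt a π s k + t * F (orbPt b π s k) := by
    intro k
    induction k with
    | zero => intro _ s; simp only [orbPt_zero, pre_add, pre_smul, hFl]
    | succ k ih =>
      intro hk s
      have ih := ih (by omega) s
      obtain ⟨j, hj⟩ := exists_mem_block (orbPt_mem (π := π) ha s k)
      have hm := hmem s k j (by omega) hj ih
      have hj' := (hit s k j (by omega)).1 hj
      rw [orbPt_succ, iet_of_mem hpos hm, orbPt_succ, iet_of_mem ha hj, ih,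
        hFs s k j (by omega) hj', wvec_add, wvec_smul]
      ring
  refine ⟨code_eq_iff.2 ⟨fun s k j hk => ?_, fun s k s' k' hk hk' => ?_⟩, ?_⟩
  · rw [← hit s k j hk]
    refine ⟨fun h => ?_, fun h => hmem s k j hk h (key k hk s)⟩
    obtain ⟨i, hi⟩ := exists_mem_block (orbPt_mem (π := π) ha s k)
    rwa [block_unique hpos h (hmem s k i hk hi (key k hk s))]
  · rw [key k hk, key k' hk']
    constructor
    · intro h
      by_contra! h'
      have h1 := mul_le_mul_of_nonneg_left (hF h'.le) ht
      have h2 := (hord s k s' k' hk hk').not.2 (not_le.2 h')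
      linarith
    · intro h
      have h1 := mul_le_mul_of_nonneg_left (hF h) ht
      have h2 := (hord s k s' k' hk hk').2 h
      linarith
  · intro s k s' k' hk hk' h1 h2
    have h3 := mul_le_mul_of_nonneg_left (hsep s k s' k' hk hk' h1 h2) ht
    have h4 := (hord s k s' k' hk hk').2 (h1.trans h2.le)
    rw [key k hk, key k' hk']
    linarith

lemma measurable_pre (j : Fin m) : Measurable fun lam : Fin m → ℝ => pre lam j := by
  unfold pre; fun_prop

lemma measurable_wvec (j : Fin m) : Measurable fun lam : Fin m → ℝ => wvec lam π j := by
  unfold wvec pre; fun_prop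

lemma measurableSet_mem_block {f : (Fin m → ℝ) → ℝ} (hf : Measurable f) (j : Fin m) :
    MeasurableSet {lam | f lam ∈ block lam j} :=
  (measurableSet_le (measurable_pre j) hf).inter
    (measurableSet_lt hf ((measurable_pre j).add (measurable_pi_apply j)))

lemma measurable_orbPt (s : Fin m) (k : ℕ) :
    Measurable fun lam : Fin m → ℝ => orbPt lam π s k := by
  induction k with
  | zero => exact measurable_pre s
  | succ k ih =>
    simp only [orbPt_succ, iet]
    exact ih.add (Finset.measurable_sum _ fun j _ =>
      Measurable.ite (measurableSet_mem_block ih j) (measurable_wvec j) measurable_const)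

lemma measurableSet_code_eq (N : ℕ) (b : Fin m → ℝ) :
    MeasurableSet {a | code π N a = code π N b} := by
  simp only [code, Prod.mk.injEq, Set.ext_iff, mem_ofPred_eq, ofPred_and, ofPred_forall]
  refine MeasurableSet.inter (MeasurableSet.iInter fun q => ?_) (MeasurableSet.iInter fun q => ?_)
  · exact (measurableSet_mem_block (measurable_orbPt _ _) _).iff (MeasurableSet.const _)
  · exact (measurableSet_le (measurable_orbPt _ _) (measurable_orbPt _ _)).iff
      (MeasurableSet.const _)

/-- The open simplex of positive vectors with sum less than `R`. -/
def simplexLT (m : ℕ) (R : ℝ) : Set (Fin m → ℝ) := {a | (∀ j, 0 < a j) ∧ ∑ j, a j < R}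

lemma volume_simplexLT_lt_top (R : ℝ) : volume (simplexLT m R) < ⊤ := by
  have : simplexLT m R ⊆ Set.pi univ fun _ => Icc 0 R := by
    intro a ha j _
    refine ⟨(ha.1 j).le, ?_⟩
    exact (Finset.single_le_sum (fun i _ => (ha.1 i).le) (Finset.mem_univ j)).trans ha.2.le
  refine (measure_mono this).trans_lt ?_
  exact (isCompact_univ_pi fun _ => isCompact_Icc).measure_lt_top

/-- Measure estimate for a set of length vectors having, in each cell, two points on either side
of some `x₀` that are too close. -/
lemma volume_simplexLT_le_diff (N : ℕ) {τ : ℝ} (hτ : 0 ≤ τ) (R : ℝ) (E : Set (Fin m → ℝ))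
    (hE : ∀ b : Fin m → ℝ, (∀ j, 0 < b j) → ∃ x₀ ∈ Ico 0 (∑ i, b i),
      ∀ a ∈ E, (∀ j, 0 < a j) → code π N a = code π N b → ∃ s k s' k', k ≤ N ∧ k' ≤ N ∧
        orbPt b π s k ≤ x₀ ∧ x₀ < orbPt b π s' k' ∧ orbPt a π s' k' < orbPt a π s k + τ) :
    volume (simplexLT m (R - τ * (m * (N + 1) + 1))) ≤ volume (simplexLT m R \ E) := by
  set D := simplexLT m (R - τ * (m * (N + 1) + 1)) with hD
  have hcell : ∀ c, volume (D ∩ code π N ⁻¹' {c}) ≤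
      volume ((simplexLT m R \ E) ∩ code π N ⁻¹' {c}) := by
    intro c
    rcases (D ∩ code π N ⁻¹' {c}).eq_empty_or_nonempty with h | ⟨b, hb, rfl⟩
    · simp [h]
    obtain ⟨x₀, hx₀, hx₀E⟩ := hE b hb.1
    obtain ⟨v, hv0, hv, hshift⟩ := exists_cell_shift (π := π) hb.1 N hx₀
    rw [← measure_preimage_add_right volume (-(τ • v)) (D ∩ code π N ⁻¹' {code π N b})]
    refine measure_mono fun a' ha' => ?_
    obtain ⟨a, rfl⟩ : ∃ a, a' = a + τ • v := ⟨a' + -(τ • v), by simp⟩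
    have ha : a ∈ D ∩ code π N ⁻¹' {code π N b} := by simpa using ha'
    obtain ⟨h1, h2⟩ := hshift a ha.1.1 ha.2 τ hτ
    have hpos : ∀ j, 0 < (a + τ • v) j := fun j => by
      have := mul_nonneg hτ (hv0 j)
      simpa using add_pos_of_pos_of_nonneg (ha.1.1 j) this
    refine ⟨⟨⟨hpos, ?_⟩, fun hmem => ?_⟩, h1⟩
    · have h3 := ha.1.2
      have h4 := mul_le_mul_of_nonneg_left hv hτ
      simp only [Pi.add_apply, Pi.smul_apply, smul_eq_mul, Finset.sum_add_distrib,
        ← Finset.mul_sum]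
      linarith
    · obtain ⟨s, k, s', k', hk, hk', hs, hs', hlt⟩ := hx₀E _ hmem hpos h1
      exact absurd (h2 s k s' k' hk hk' hs hs') (not_le.2 hlt)
  have hmeas : ∀ c, MeasurableSet (code π N ⁻¹' {c}) := by
    intro c
    rcases (code π N ⁻¹' {c}).eq_empty_or_nonempty with h | ⟨b, rfl⟩
    · simp [h]
    · exact measurableSet_code_eq N b
  cases nonempty_fintype (Set ((Fin m × Fin (N + 1)) × Fin m) ×
    Set ((Fin m × Fin (N + 1)) × (Fin m × Fin (N + 1))))
  have hsum : ∀ A : Set (Fin m → ℝ), volume A = ∑ c, volume (A ∩ code π N ⁻¹' {c}) := by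
    intro A
    have := sum_measure_preimage_singleton (μ := volume.restrict A) Finset.univ
      (f := code π N) fun c _ => hmeas c
    simp only [Finset.coe_univ, preimage_univ, Measure.restrict_apply MeasurableSet.univ,
      univ_inter] at this
    rw [← this]
    exact Finset.sum_congr rfl fun c _ => by
      rw [Measure.restrict_apply (hmeas c), inter_comm]
  rw [hsum D, hsum (simplexLT m R \ E)]
  exact Finset.sum_le_sum fun c _ => hcell c

end Cells

section Connections

variable {m : ℕ} {π : Equiv.Perm (Fin m)}

/-- Among the sets of a given cardinality, the initial segment has the least sum. -/
lemma sum_filter_lt_le_sum (j : Fin m) (B : Finset (Fin m))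
    (hB : B.card = (Finset.univ.filter (fun i : Fin m => i < j)).card) :
    ∑ i ∈ Finset.univ.filter (fun i : Fin m => i < j), (i : ℝ) ≤ ∑ i ∈ B, (i : ℝ) ∧
      (B ≠ Finset.univ.filter (fun i : Fin m => i < j) →
        ∑ i ∈ Finset.univ.filter (fun i : Fin m => i < j), (i : ℝ) < ∑ i ∈ B, (i : ℝ)) := by
  set A := Finset.univ.filter (fun i : Fin m => i < j) with hA
  have hcard : (B.card : ℝ) = A.card := by exact_mod_cast hB
  have h1 : ∑ i ∈ B, ((i : ℝ) - j) = ∑ i ∈ B, (i : ℝ) - A.card * j := by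
    rw [Finset.sum_sub_distrib, Finset.sum_const, nsmul_eq_mul, hcard]
  have h2 : ∑ i ∈ A, ((i : ℝ) - j) = ∑ i ∈ A, (i : ℝ) - A.card * j := by
    rw [Finset.sum_sub_distrib, Finset.sum_const, nsmul_eq_mul]
  have h3 := Finset.sum_inter_add_sum_sdiff A B fun i : Fin m => (i : ℝ) - j
  have h4 := Finset.sum_inter_add_sum_sdiff B A fun i : Fin m => (i : ℝ) - j
  rw [Finset.inter_comm] at h4
  have h5 : 0 ≤ ∑ i ∈ B \ A, ((i : ℝ) - j) := by
    refine Finset.sum_nonneg fun i hi => ?_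
    simp only [hA, Finset.mem_sdiff, Finset.mem_filter, Finset.mem_univ, true_and, not_lt] at hi
    have : (j : ℕ) ≤ i := hi.2
    have : ((j : ℕ) : ℝ) ≤ (i : ℕ) := by exact_mod_cast this
    linarith
  have hneg : ∀ i ∈ A \ B, ((i : ℝ) - j) < 0 := by
    intro i hi
    simp only [hA, Finset.mem_sdiff, Finset.mem_filter, Finset.mem_univ, true_and] at hi
    have : (i : ℕ) < j := hi.1
    have : ((i : ℕ) : ℝ) < (j : ℕ) := by exact_mod_cast this
    linarith
  constructor
  · have := Finset.sum_nonpos fun i hi => (hneg i hi).le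
    linarith
  · intro hne
    have hne' : (A \ B).Nonempty := by
      rw [Finset.sdiff_nonempty]
      exact fun h => hne (Finset.eq_of_subset_of_card_le h hB.le).symm
    have := Finset.sum_neg hneg hne'
    linarith

/-- The displacement vector of the permutation. -/
def dispVec (π : Equiv.Perm (Fin m)) (i : Fin m) : ℝ := (π i : ℝ) - i

lemma sum_dispVec_nonpos (π : Equiv.Perm (Fin m)) (j : Fin m) :
    ∑ i ∈ Finset.univ.filter (fun i => π i < π j), dispVec π i ≤ 0 := by
  set B := Finset.univ.filter (fun i => π i < π j)
  have hB : B.map π.toEmbedding = Finset.univ.filter (fun i => i < π j) := by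
    ext i
    simp only [B, Finset.mem_map_equiv, Finset.mem_filter, Finset.mem_univ, true_and,
      Equiv.apply_symm_apply]
  have h1 := (sum_filter_lt_le_sum (π j) B (by rw [← hB, Finset.card_map])).1
  rw [← hB, Finset.sum_map] at h1
  simp only [dispVec, Finset.sum_sub_distrib]
  simpa using h1

lemma pre_dispVec_pos (hirr : PermIrreducible π) {j : Fin m} (hj : 0 < (j : ℕ)) :
    0 < pre (dispVec π) j := by
  set A := Finset.univ.filter (fun i : Fin m => i < j) with hA
  have h1 := (sum_filter_lt_le_sum j (A.map π.toEmbedding) (by rw [Finset.card_map])).2 (by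
    intro h
    have h2 := hirr j hj j.isLt.le
    have h3 : (Finset.univ.filter fun i : Fin m => (i : ℕ) < (j : ℕ)) = A := rfl
    rw [h3] at h2
    have := h2 (by rw [← hA, Finset.map_eq_image] at h; exact h)
    exact absurd j.isLt (by omega))
  rw [Finset.sum_map] at h1
  simp only [pre, dispVec, Finset.sum_sub_distrib]
  simpa using h1

lemma pre_dispVec_nonneg (hirr : PermIrreducible π) (j : Fin m) : 0 ≤ pre (dispVec π) j := by
  rcases Nat.eq_zero_or_pos (j : ℕ) with h | h
  · rw [pre_of_val_eq_zero h]
  · exact (pre_dispVec_pos hirr h).le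

lemma wvec_dispVec_nonpos (hirr : PermIrreducible π) (j : Fin m) : wvec (dispVec π) π j ≤ 0 := by
  have h1 := sum_dispVec_nonpos π j
  have h2 := pre_dispVec_nonneg hirr j
  rw [wvec]; linarith

/-- The linear functional whose vanishing means that the orbit of the `s`-th left endpoint,
following the itinerary `l`, hits the `j`-th one. -/
def connectionMap (π : Equiv.Perm (Fin m)) (s j : Fin m) (l : List (Fin m)) :
    (Fin m → ℝ) →ₗ[ℝ] ℝ where
  toFun a := pre a s + wvec a π s + (l.map (wvec a π)).sum - pre a j
  map_add' a b := by
    have : (l.map (wvec (a + b) π)).sum = (l.map (wvec a π)).sum + (l.map (wvec b π)).sum := by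
      induction l with
      | nil => simp
      | cons i l ih => simp only [List.map_cons, List.sum_cons, ih, wvec_add]; ring
    rw [this, pre_add, pre_add, wvec_add]; ring
  map_smul' t a := by
    have : (l.map (wvec (t • a) π)).sum = t * (l.map (wvec a π)).sum := by
      induction l with
      | nil => simp
      | cons i l ih => simp only [List.map_cons, List.sum_cons, ih, wvec_smul]; ring
    simp only [this, pre_smul, wvec_smul, RingHom.id_apply, smul_eq_mul]; ring

lemma ker_connectionMap_ne_top (hirr : PermIrreducible π) (s : Fin m) {j : Fin m}
    (hj : 0 < (j : ℕ)) (l : List (Fin m)) : LinearMap.ker (connectionMap π s j l) ≠ ⊤ := by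
  intro h
  have h0 : dispVec π ∈ LinearMap.ker (connectionMap π s j l) := h ▸ Submodule.mem_top
  have h1 : pre (dispVec π) s + wvec (dispVec π) π s + (l.map (wvec (dispVec π) π)).sum -
      pre (dispVec π) j = 0 := h0
  have h2 : (l.map (wvec (dispVec π) π)).sum ≤ 0 := by
    clear h h0 h1
    induction l with
    | nil => simp
    | cons i l ih =>
      simp only [List.map_cons, List.sum_cons]
      linarith [wvec_dispVec_nonpos hirr i]
  have h3 := pre_dispVec_pos hirr hj
  have h4 := sum_dispVec_nonpos π s
  rw [wvec] at h1
  linarith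

lemma exists_orbPt_succ_eq {lam : Fin m → ℝ} (hpos : ∀ j, 0 < lam j) (s : Fin m) (k : ℕ) :
    ∃ l : List (Fin m),
      orbPt lam π s (k + 1) = pre lam s + wvec lam π s + (l.map (wvec lam π)).sum := by
  induction k with
  | zero => exact ⟨[], by simp [orbPt_succ, orbPt_zero, iet_of_mem hpos (pre_mem_block hpos s)]⟩
  | succ k ih =>
    obtain ⟨l, hl⟩ := ih
    obtain ⟨j, hj⟩ := exists_mem_block (orbPt_mem (π := π) hpos s (k + 1))
    refine ⟨j :: l, ?_⟩
    rw [orbPt_succ, iet_of_mem hpos hj, hl, List.map_cons, List.sum_cons]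
    ring

/-- For almost every length vector there are no connections between discontinuities. -/
lemma ae_orbPt_ne_pre (hirr : PermIrreducible π) :
    ∀ᵐ lam ∂(volume : Measure (Fin m → ℝ)), (∀ j, 0 < lam j) →
      ∀ (s j : Fin m) (k : ℕ), 0 < (j : ℕ) → orbPt lam π s (k + 1) ≠ pre lam j := by
  have h : ∀ᵐ lam ∂(volume : Measure (Fin m → ℝ)), ∀ (s j : Fin m) (l : List (Fin m)),
      0 < (j : ℕ) → connectionMap π s j l lam ≠ 0 := by
    refine ae_all_iff.2 fun s => ae_all_iff.2 fun j => ae_all_iff.2 fun l => ?_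
    by_cases hj : 0 < (j : ℕ)
    · have := Measure.addHaar_submodule (volume : Measure (Fin m → ℝ)) _
        (ker_connectionMap_ne_top hirr s hj l)
      filter_upwards [measure_eq_zero_iff_ae_notMem.1 this] with lam hlam _ h0
      exact hlam h0
    · exact Filter.Eventually.of_forall fun _ h => absurd h hj
  filter_upwards [h] with lam hlam hpos s j k hj he
  obtain ⟨l, hl⟩ := exists_orbPt_succ_eq (π := π) hpos s k
  refine hlam s j l hj ?_
  change pre lam s + wvec lam π s + (l.map (wvec lam π)).sum - pre lam j = 0
  rw [← hl, he, sub_self]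

end Connections

section Recurrence

variable {m : ℕ} {π : Equiv.Perm (Fin m)}

/-- Some orbit point of time at most `N` lies strictly to the right of the `j`-th left endpoint,
within `τ`. -/
def nearRight (π : Equiv.Perm (Fin m)) (N : ℕ) (τ : ℝ) (j : Fin m) : Set (Fin m → ℝ) :=
  {a | ∃ s k, k ≤ N ∧ orbPt a π j 0 < orbPt a π s k ∧ orbPt a π s k < orbPt a π j 0 + τ}

/-- Some orbit point of time at most `N` lies strictly to the left of the `j`-th left endpoint,
within `τ`. -/
def nearLeft (π : Equiv.Perm (Fin m)) (N : ℕ) (τ : ℝ) (j : Fin m) : Set (Fin m → ℝ) :=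
  {a | ∃ s k, k ≤ N ∧ orbPt a π s k < orbPt a π j 0 ∧ orbPt a π j 0 < orbPt a π s k + τ}

lemma measurableSet_nearRight (N : ℕ) (τ : ℝ) (j : Fin m) :
    MeasurableSet (nearRight π N τ j) := by
  simp only [nearRight, ofPred_exists]
  refine MeasurableSet.iUnion fun s => MeasurableSet.iUnion fun k => ?_
  exact (MeasurableSet.const _).inter
    ((measurableSet_lt (measurable_orbPt _ _) (measurable_orbPt _ _)).inter
      (measurableSet_lt (measurable_orbPt _ _) ((measurable_orbPt _ _).add_const _)))

lemma measurableSet_nearLeft (N : ℕ) (τ : ℝ) (j : Fin m) :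
    MeasurableSet (nearLeft π N τ j) := by
  simp only [nearLeft, ofPred_exists]
  refine MeasurableSet.iUnion fun s => MeasurableSet.iUnion fun k => ?_
  exact (MeasurableSet.const _).inter
    ((measurableSet_lt (measurable_orbPt _ _) (measurable_orbPt _ _)).inter
      (measurableSet_lt (measurable_orbPt _ _) ((measurable_orbPt _ _).add_const _)))

lemma volume_simplexLT_le_diff_nearRight (N : ℕ) {τ : ℝ} (hτ : 0 ≤ τ) (R : ℝ) (j : Fin m) :
    volume (simplexLT m (R - τ * (m * (N + 1) + 1))) ≤
      volume (simplexLT m R \ nearRight π N τ j) := by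
  refine volume_simplexLT_le_diff (π := π) N hτ R _ fun b hb =>
    ⟨orbPt b π j 0, orbPt_mem hb j 0, ?_⟩
  rintro a ⟨s, k, hk, h1, h2⟩ ha hab
  rw [code_eq_iff] at hab
  refine ⟨j, 0, s, k, N.zero_le, hk, le_rfl, ?_, h2⟩
  exact not_le.1 ((hab.2 s k j 0 hk N.zero_le).not.1 (not_le.2 h1))

lemma volume_simplexLT_le_diff_nearLeft (N : ℕ) {τ : ℝ} (hτ : 0 ≤ τ) (R : ℝ) (j : Fin m) :
    volume (simplexLT m (R - τ * (m * (N + 1) + 1))) ≤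
      volume (simplexLT m R \ nearLeft π N τ j) := by
  refine volume_simplexLT_le_diff (π := π) N hτ R _ fun b hb => ?_
  set A := (Finset.univ.filter fun p : Fin m × Fin (N + 1) =>
    orbPt b π p.1 p.2 < orbPt b π j 0) with hA
  have hmem : ∀ s k, k ≤ N → orbPt b π s k < orbPt b π j 0 →
      ∃ p ∈ A, orbPt b π s k = orbPt b π p.1 p.2 := fun s k hk h =>
    ⟨(s, ⟨k, by omega⟩), by simpa [hA] using h, rfl⟩
  have hbad : ∀ a ∈ nearLeft π N τ j, code π N a = code π N b → ∃ s k, k ≤ N ∧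
      orbPt b π s k < orbPt b π j 0 ∧ orbPt a π j 0 < orbPt a π s k + τ := by
    rintro a ⟨s, k, hk, h1, h2⟩ hab
    rw [code_eq_iff] at hab
    exact ⟨s, k, hk, not_le.1 ((hab.2 j 0 s k N.zero_le hk).not.1 (not_le.2 h1)), h2⟩
  rcases A.eq_empty_or_nonempty with h | h
  · refine ⟨orbPt b π j 0, orbPt_mem hb j 0, fun a ha _ hab => ?_⟩
    obtain ⟨s, k, hk, h1, -⟩ := hbad a ha hab
    obtain ⟨p, hp, -⟩ := hmem s k hk h1
    simp [h] at hp
  · obtain ⟨q, hq, hmax⟩ := A.exists_max_image (fun p => orbPt b π p.1 p.2) h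
    refine ⟨orbPt b π q.1 q.2, orbPt_mem hb _ _, fun a ha _ hab => ?_⟩
    obtain ⟨s, k, hk, h1, h2⟩ := hbad a ha hab
    obtain ⟨p, hp, he⟩ := hmem s k hk h1
    exact ⟨s, k, j, 0, hk, N.zero_le, he ▸ hmax p hp, by simpa [hA] using hq, h2⟩

lemma simplexLT_mono {R R' : ℝ} (h : R ≤ R') : simplexLT m R ⊆ simplexLT m R' :=
  fun _ ha => ⟨ha.1, ha.2.trans_le h⟩

lemma tendsto_volume_simplexLT (R c : ℝ) (hc : 0 ≤ c) :
    Filter.Tendsto (fun n : ℕ => volume (simplexLT m (R - 1 / (n + 1) * c))) Filter.atTop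
      (nhds (volume (simplexLT m R))) := by
  have hmono : Monotone fun n : ℕ => simplexLT m (R - 1 / (n + 1) * c) := by
    intro n n' h
    refine simplexLT_mono ?_
    have := mul_le_mul_of_nonneg_right (Nat.one_div_le_one_div (α := ℝ) h) hc
    linarith
  have hU : ⋃ n : ℕ, simplexLT m (R - 1 / (n + 1) * c) = simplexLT m R := by
    refine Subset.antisymm (iUnion_subset fun n => simplexLT_mono ?_) fun a ha => ?_
    · have := mul_nonneg (Nat.one_div_pos_of_nat (α := ℝ) (n := n)).le hc
      linarith
    · have h1 : Filter.Tendsto (fun n : ℕ => R - 1 / ((n : ℝ) + 1) * c) Filter.atTop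
          (nhds (R - 0 * c)) := (tendsto_one_div_add_atTop_nhds_zero_nat.mul_const c).const_sub R
      rw [zero_mul, sub_zero] at h1
      obtain ⟨n, hn⟩ := (h1.eventually (lt_mem_nhds ha.2)).exists
      exact mem_iUnion.2 ⟨n, ha.1, hn⟩
  rw [← hU]
  exact tendsto_measure_iUnion_atTop hmono

/-- The orbit points of positive time at most `M` are `ε`-far from all discontinuities. -/
def FarOrbits (lam : Fin m → ℝ) (π : Equiv.Perm (Fin m)) (M : ℕ) (ε : ℝ) : Prop :=
  ∀ (s j : Fin m) (k : ℕ), 0 < (j : ℕ) → 1 ≤ k → k ≤ M → ε ≤ |orbPt lam π s k - pre lam j|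

lemma ae_frequently_notMem_near (R : ℝ) :
    ∀ᵐ lam ∂(volume : Measure (Fin m → ℝ)), lam ∈ simplexLT m R →
      ∃ n : ℕ, ∃ᶠ N : ℕ in Filter.atTop, ∀ j,
        lam ∉ nearRight π N (1 / (n + 1) / (N + 1)) j ∧
        lam ∉ nearLeft π N (1 / (n + 1) / (N + 1)) j := by
  set bad : ℕ → ℕ → Set (Fin m → ℝ) := fun n N => ⋃ j,
    simplexLT m R ∩ (nearRight π N (1 / (n + 1) / (N + 1)) j ∪
      nearLeft π N (1 / (n + 1) / (N + 1)) j) with hbad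
  set δ : ℕ → ENNReal := fun n =>
    volume (simplexLT m R) - volume (simplexLT m (R - 1 / (n + 1) * (m + 1))) with hδ
  have hE : ∀ (n N : ℕ) (E : Set (Fin m → ℝ)), MeasurableSet E →
      volume (simplexLT m (R - 1 / (n + 1) / (N + 1) * (m * (N + 1) + 1))) ≤
        volume (simplexLT m R \ E) → volume (simplexLT m R ∩ E) ≤ δ n := by
    intro n N E hEm h
    have h1 : simplexLT m (R - 1 / (n + 1) * (m + 1)) ⊆
        simplexLT m (R - 1 / (n + 1) / (N + 1) * (m * (N + 1) + 1)) := by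
      refine simplexLT_mono ?_
      have h2 : (0 : ℝ) < N + 1 := by positivity
      have h3 : 1 / ((n : ℝ) + 1) / (N + 1) * (m * (N + 1) + 1) =
          1 / ((n : ℝ) + 1) * (m + 1 / (N + 1)) := by field_simp
      rw [h3]
      have h4 : 1 / ((N : ℝ) + 1) ≤ 1 := by
        rw [div_le_one h2]; linarith [N.cast_nonneg (α := ℝ)]
      have h5 : (0 : ℝ) ≤ 1 / ((n : ℝ) + 1) := by positivity
      have := mul_le_mul_of_nonneg_left (add_le_add_right h4 (m : ℝ)) h5
      linarith
    have h2 := (measure_mono h1).trans h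
    have h3 := measure_inter_add_sdiff (μ := volume) (simplexLT m R) hEm
    refine ENNReal.le_sub_of_add_le_right ?_ ?_
    · exact (volume_simplexLT_lt_top _).ne
    · rw [← h3]
      exact add_le_add_right h2 _
  have hbad_le : ∀ n N, volume (bad n N) ≤ m * (2 * δ n) := by
    intro n N
    have hτ : (0 : ℝ) ≤ 1 / ((n : ℝ) + 1) / (N + 1) := by positivity
    refine (measure_iUnion_fintype_le _ _).trans ?_
    calc _ ≤ ∑ _j : Fin m, 2 * δ n := Finset.sum_le_sum fun j _ => ?_
      _ = _ := by simp
    rw [inter_union_distrib_left, two_mul]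
    refine (measure_union_le _ _).trans (add_le_add ?_ ?_)
    · exact hE n N _ (measurableSet_nearRight _ _ _)
        (volume_simplexLT_le_diff_nearRight N hτ R j)
    · exact hE n N _ (measurableSet_nearLeft _ _ _)
        (volume_simplexLT_le_diff_nearLeft N hτ R j)
  have hlim : ∀ n, volume (⋃ K, ⋂ N ≥ K, bad n N) ≤ m * (2 * δ n) := by
    intro n
    rw [Monotone.measure_iUnion]
    · exact iSup_le fun K => (measure_mono (iInter₂_subset K le_rfl)).trans (hbad_le n K)
    · intro K K' h
      exact biInter_subset_biInter_left fun N hN => le_trans h hN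
  have hδ0 : Filter.Tendsto (fun n => m * (2 * δ n)) Filter.atTop (nhds 0) := by
    have h1 : Filter.Tendsto δ Filter.atTop
        (nhds (volume (simplexLT m R) - volume (simplexLT m R))) :=
      ENNReal.Tendsto.sub tendsto_const_nhds
        (tendsto_volume_simplexLT R (m + 1) (by positivity))
        (Or.inl (volume_simplexLT_lt_top _).ne)
    rw [tsub_self] at h1
    have h2 := ENNReal.Tendsto.const_mul (a := 2) h1 (Or.inr (by simp))
    have h3 := ENNReal.Tendsto.const_mul (a := (m : ENNReal)) h2 (Or.inr (by simp))
    simpa using h3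
  have hZ : volume (⋂ n, ⋃ K, ⋂ N ≥ K, bad n N) = 0 := by
    refine le_antisymm (ge_of_tendsto' hδ0 fun n => ?_) bot_le
    exact (measure_mono (iInter_subset _ n)).trans (hlim n)
  filter_upwards [measure_eq_zero_iff_ae_notMem.1 hZ] with lam hlam hR
  simp only [mem_iInter, mem_iUnion, not_forall, not_exists] at hlam
  obtain ⟨n, hn⟩ := hlam
  refine ⟨n, Filter.frequently_atTop.2 fun K => ?_⟩
  obtain ⟨N, hN, h⟩ := hn K
  refine ⟨N, hN, fun j => ?_⟩
  have hj : lam ∉ simplexLT m R ∩ (nearRight π N (1 / (n + 1) / (N + 1)) j ∪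
      nearLeft π N (1 / (n + 1) / (N + 1)) j) := fun h' => h (mem_iUnion.2 ⟨j, h'⟩)
  rw [mem_inter_iff, not_and, mem_union, not_or] at hj
  exact hj hR

/-- For almost every length vector, infinitely often the orbits of the discontinuities stay at
distance comparable to the inverse of time from the discontinuities. -/
theorem ae_frequently_farOrbits (hirr : PermIrreducible π) :
    ∀ᵐ lam ∂(volume : Measure (Fin m → ℝ)), (∀ j, 0 < lam j) →
      ∃ c > 0, ∃ᶠ M : ℕ in Filter.atTop, FarOrbits lam π M (c / (M + 1)) := by
  filter_upwards [ae_orbPt_ne_pre hirr,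
    ae_all_iff.2 fun R : ℕ => ae_frequently_notMem_near (π := π) R] with lam h1 h2 hpos
  obtain ⟨R, hR⟩ := exists_nat_gt (∑ i, lam i)
  obtain ⟨n, hn⟩ := h2 R ⟨hpos, hR⟩
  refine ⟨1 / (n + 1), by positivity, hn.mono fun N hN s j k hj hk hkN => ?_⟩
  obtain ⟨hr, hl⟩ := hN j
  have hne := h1 hpos s j (k - 1) hj
  rw [Nat.sub_add_cancel hk] at hne
  by_contra! hlt
  rw [abs_lt] at hlt
  rcases lt_or_gt_of_ne hne with h | h
  · exact hl ⟨s, k, hkN, h, by rw [orbPt_zero]; linarith⟩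
  · exact hr ⟨s, k, hkN, h, by rw [orbPt_zero]; linarith⟩

end Recurrence

section Towers

variable {m : ℕ} {lam : Fin m → ℝ} {π : Equiv.Perm (Fin m)}

lemma mem_block_of_far (hpos : ∀ j, 0 < lam j) {x y : ℝ} {j : Fin m} (hx : x ∈ block lam j)
    (hxI : x ∈ Ico 0 (∑ i, lam i)) (hy : y ∈ Ico 0 (∑ i, lam i))
    (h : ∀ r : Fin m, 0 < (r : ℕ) → |x - y| < |y - pre lam r|) : y ∈ block lam j := by
  rcases le_total x y with hxy | hxy
  · refine mem_block_of_le hx hxy hy.2 fun k hk hmem => ?_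
    have := h k hk
    rw [abs_sub_comm x, abs_of_nonneg (sub_nonneg.2 hxy),
      abs_of_nonneg (sub_nonneg.2 hmem.2)] at this
    linarith [hmem.1]
  · obtain ⟨i, hi⟩ := exists_mem_block hy
    have hxi := mem_block_of_le hi hxy hxI.2 fun k hk hmem => by
      have := h k hk
      rw [abs_of_nonneg (sub_nonneg.2 hxy), abs_sub_comm,
        abs_of_nonneg (sub_nonneg.2 hmem.1.le)] at this
      linarith [hmem.2]
    rwa [block_unique hpos hx hxi]

/-- To the left of any point there is an interval on which the first iterates are translations,
starting at zero or at a preimage of a discontinuity. -/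
lemma exists_left_end (hpos : ∀ j, 0 < lam j) {z : ℝ} (hz : z ∈ Ico 0 (∑ i, lam i)) (p : ℕ) :
    ∃ a, 0 ≤ a ∧ a ≤ z ∧
      (∀ i ≤ p, ∀ x ∈ Icc a z, (iet lam π)^[i] x = (iet lam π)^[i] a + (x - a)) ∧
      (a = 0 ∨ ∃ i < p, ∃ s : Fin m, 0 < (s : ℕ) ∧ (iet lam π)^[i] a = pre lam s) := by
  induction p with
  | zero =>
    refine ⟨0, le_rfl, hz.1, fun i hi x _ => ?_, Or.inl rfl⟩
    obtain rfl : i = 0 := by omega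
    simp
  | succ p ih =>
    obtain ⟨a, ha0, haz, htr, hend⟩ := ih
    have haI : a ∈ Ico 0 (∑ i, lam i) := ⟨ha0, haz.trans_lt hz.2⟩
    have hzp := htr p le_rfl z ⟨haz, le_rfl⟩
    obtain ⟨j, hj⟩ := exists_mem_block (iterate_iet_mem_Ico (π := π) hpos hz p)
    obtain ⟨i, hi⟩ := exists_mem_block (iterate_iet_mem_Ico (π := π) hpos haI p)
    have key : ∀ a', a ≤ a' → a' ≤ z → (iet lam π)^[p] a' ∈ block lam j →
        ∀ i ≤ p + 1, ∀ x ∈ Icc a' z, (iet lam π)^[i] x = (iet lam π)^[i] a' + (x - a') := by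
      intro a' h1 h2 h3 i hi x hx
      have htr' : ∀ i ≤ p, ∀ x ∈ Icc a' z,
          (iet lam π)^[i] x = (iet lam π)^[i] a' + (x - a') := by
        intro i hi x hx
        rw [htr i hi x ⟨h1.trans hx.1, hx.2⟩, htr i hi a' ⟨h1, h2⟩]
        ring
      rcases Nat.lt_or_ge p i with h | h
      · obtain rfl : i = p + 1 := by omega
        have hx' : (iet lam π)^[p] x ∈ block lam j := by
          have h4 := htr' p le_rfl x hx
          have h5 := htr' p le_rfl z ⟨h2, le_rfl⟩
          refine ⟨?_, ?_⟩
          · linarith [h3.1, hx.1]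
          · linarith [hj.2, hx.2]
        rw [Function.iterate_succ_apply', Function.iterate_succ_apply', iet_of_mem hpos hx',
          iet_of_mem hpos h3, htr' p le_rfl x hx]
        ring
      · exact htr' i h x hx
    by_cases hij : i = j
    · subst hij
      refine ⟨a, ha0, haz, key a le_rfl haz hi, hend.imp_right ?_⟩
      rintro ⟨i, hi, h⟩
      exact ⟨i, by omega, h⟩
    · have hlt : i < j := by
        refine (lt_or_gt_of_ne hij).resolve_right fun h => ?_
        have := lt_of_mem_block hpos hj hi h
        linarith
      set a' := a + (pre lam j - (iet lam π)^[p] a) with ha'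
      have h1 : a ≤ a' := by
        have := hi.2.trans_le (pre_add_self_le_pre hpos hlt)
        linarith
      have h2 : a' ≤ z := by linarith [hj.1]
      have h3 : (iet lam π)^[p] a' = pre lam j := by
        rw [htr p le_rfl a' ⟨h1, h2⟩, ha']; ring
      refine ⟨a', ha0.trans h1, h2, key a' h1 h2 (h3 ▸ pre_mem_block hpos j),
        Or.inr ⟨p, by omega, j, ?_, h3⟩⟩
      exact (Nat.zero_le _).trans_lt (Fin.lt_def.1 hlt)

lemma iet_pre_symm_zero (hpos : ∀ j, 0 < lam j) {s : Fin m} (hs : (π s : ℕ) = 0) :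
    iet lam π (pre lam s) = 0 := by
  rw [iet_pre hpos, pre_of_val_eq_zero hs]

lemma pos_of_perm_eq_zero (hm : 2 ≤ m) (hirr : PermIrreducible π) {s : Fin m}
    (hs : (π s : ℕ) = 0) : 0 < (s : ℕ) := by
  by_contra! h
  have h1 : (Finset.univ.filter fun i : Fin m => (i : ℕ) < 1) = {s} := by
    ext i
    simp only [Finset.mem_filter, Finset.mem_univ, true_and, Finset.mem_singleton, Fin.ext_iff]
    omega
  have h2 : π s = s := Fin.ext (by omega)
  have := hirr 1 le_rfl (by omega) (by rw [h1, Finset.image_singleton, h2])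
  omega

/-- Points do not return close to themselves while discontinuities stay far from each other. -/
lemma le_abs_iterate_sub_self (hm : 2 ≤ m) (hirr : PermIrreducible π) (hpos : ∀ j, 0 < lam j)
    {M : ℕ} {ε : ℝ} (hfar : FarOrbits lam π M ε) (hε : ∀ j, ε ≤ lam j) {p : ℕ} (hp : 1 ≤ p)
    (hpM : p ≤ M) {z : ℝ} (hz : z ∈ Ico 0 (∑ i, lam i)) : ε ≤ |(iet lam π)^[p] z - z| := by
  by_contra! hlt
  obtain ⟨a, ha0, haz, htr, hend⟩ := exists_left_end (π := π) hpos hz p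
  have haI : a ∈ Ico 0 (∑ i, lam i) := ⟨ha0, haz.trans_lt hz.2⟩
  set δ := (iet lam π)^[p] z - z with hδ
  have hpa : (iet lam π)^[p] a = a + δ := by
    have := htr p le_rfl z ⟨haz, le_rfl⟩
    linarith
  have hcontra : ∀ s : Fin m, 0 < (s : ℕ) → (iet lam π)^[p] (pre lam s) ≠ pre lam s + δ := by
    intro s hs he
    have := hfar s s p hs hp hpM
    rw [orbPt, he, add_sub_cancel_left] at this
    linarith
  rcases hend with rfl | ⟨i, hi, s, hs, his⟩
  · rw [zero_add] at hpa
    set s := π.symm ⟨0, by omega⟩ with hs_def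
    have hs : (π s : ℕ) = 0 := by simp [hs_def]
    have hδ0 : 0 ≤ δ := hpa ▸ (iterate_iet_mem_Ico hpos haI p).1
    rw [abs_of_nonneg hδ0] at hlt
    have hmem : pre lam s + δ ∈ block lam s := ⟨by linarith, by linarith [hε s]⟩
    refine hcontra s (pos_of_perm_eq_zero hm hirr hs) (iet_injOn (π := π) hpos ?_ ?_ ?_)
    · exact iterate_iet_mem_Ico hpos (pre_mem_Ico hpos s) p
    · exact block_subset hpos s hmem
    · have h1 := iet_pre_symm_zero hpos hs
      rw [iet_of_mem hpos (pre_mem_block hpos s)] at h1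
      rw [← Function.iterate_succ_apply' (iet lam π), Function.iterate_succ_apply,
        iet_pre_symm_zero hpos hs, hpa, iet_of_mem hpos hmem]
      linarith
  · have key : ∀ l ≤ i, (iet lam π)^[l] ((iet lam π)^[p] a) = (iet lam π)^[l] a + δ := by
      intro l
      induction l with
      | zero => intro _; exact hpa
      | succ l ih =>
        intro hl
        have ih := ih (by omega)
        have hI := iterate_iet_mem_Ico (π := π) hpos haI l
        have hI' := iterate_iet_mem_Ico (π := π) hpos (iterate_iet_mem_Ico (π := π) hpos haI p) l
        obtain ⟨j, hj⟩ := exists_mem_block hI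
        have hj' := mem_block_of_far hpos hj hI hI' fun r hr => by
          have h1 := hfar s r (l + p - i) hr (by omega) (by omega)
          have h2 : orbPt lam π s (l + p - i) = (iet lam π)^[l] ((iet lam π)^[p] a) := by
            rw [orbPt, ← his, ← Function.iterate_add_apply, ← Function.iterate_add_apply,
              show l + p - i + i = l + p by omega]
          rw [h2] at h1
          refine lt_of_lt_of_le ?_ h1
          rw [ih, abs_sub_comm, add_sub_cancel_left]
          exact hlt
        rw [Function.iterate_succ_apply', Function.iterate_succ_apply', iet_of_mem hpos hj',
          iet_of_mem hpos hj, ih]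
        ring
    refine hcontra s hs ?_
    rw [← his, ← key i le_rfl, ← Function.iterate_add_apply, ← Function.iterate_add_apply,
      add_comm]

/-- The window `[x, x + ε)` stays inside one block during the first `N` iterates. -/
def Travels (lam : Fin m → ℝ) (π : Equiv.Perm (Fin m)) (ε : ℝ) (N : ℕ) (x : ℝ) : Prop :=
  ∀ i < N, ∃ j, (iet lam π)^[i] x ∈ block lam j ∧ (iet lam π)^[i] x + ε ≤ pre lam j + lam j

lemma Travels.iterate_add (hpos : ∀ j, 0 < lam j) {ε : ℝ} {N : ℕ} {x : ℝ}
    (h : Travels lam π ε N x) {u : ℝ} (hu : u ∈ Ico 0 ε) {i : ℕ} (hi : i ≤ N) :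
    (iet lam π)^[i] (x + u) = (iet lam π)^[i] x + u := by
  induction i with
  | zero => rfl
  | succ i ih =>
    obtain ⟨j, h1, h2⟩ := h i (by omega)
    have h3 : (iet lam π)^[i] x + u ∈ block lam j :=
      ⟨by linarith [h1.1, hu.1], by linarith [hu.2]⟩
    rw [Function.iterate_succ_apply', Function.iterate_succ_apply', ih (by omega),
      iet_of_mem hpos h1, iet_of_mem hpos h3]
    ring

lemma iet_add_le_sum (hpos : ∀ j, 0 < lam j) {x ε : ℝ} {j : Fin m} (hx : x ∈ block lam j)
    (h : x + ε ≤ pre lam j + lam j) : iet lam π x + ε ≤ ∑ i, lam i := by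
  have h1 := pre_add_self_le_sum (permLam_pos (π := π) hpos) (π j)
  rw [pre_permLam, permLam_apply, sum_permLam] at h1
  rw [iet_of_mem hpos hx]
  linarith

lemma Travels.iterate_add_le_sum (hpos : ∀ j, 0 < lam j) {ε : ℝ} {N : ℕ} {x : ℝ}
    (h : Travels lam π ε N x) (hx : x + ε ≤ ∑ i, lam i) {i : ℕ} (hi : i ≤ N) :
    (iet lam π)^[i] x + ε ≤ ∑ i, lam i := by
  cases i with
  | zero => exact hx
  | succ i =>
    obtain ⟨j, h1, h2⟩ := h i (by omega)
    rw [Function.iterate_succ_apply']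
    exact iet_add_le_sum hpos h1 h2

/-- A window can be iterated many times inside blocks, either forwards or backwards. -/
lemma exists_travels (hpos : ∀ j, 0 < lam j) {N : ℕ} {ε : ℝ} (hε : 0 < ε)
    (hfar : FarOrbits lam π (2 * N) ε) {x : ℝ} (hx : 0 ≤ x) (hxε : x + ε ≤ ∑ i, lam i) :
    ∃ y, 0 ≤ y ∧ y + ε ≤ ∑ i, lam i ∧ Travels lam π ε N y ∧ (y = x ∨ (iet lam π)^[N] y = x) := by
  by_cases hT : Travels lam π ε N x
  · exact ⟨x, hx, hxε, hT, Or.inl rfl⟩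
  obtain ⟨n, hnN, hn, j, hj, hβ⟩ : ∃ n < N, Travels lam π ε n x ∧
      ∃ j : Fin m, 0 < (j : ℕ) ∧ pre lam j ∈ Ioo ((iet lam π)^[n] x) ((iet lam π)^[n] x + ε) := by
    have hex : ∃ n, n < N ∧ ¬ ∃ j, (iet lam π)^[n] x ∈ block lam j ∧
        (iet lam π)^[n] x + ε ≤ pre lam j + lam j := by
      simpa [Travels] using hT
    obtain ⟨h1, h2⟩ := Nat.find_spec hex
    have hn : Travels lam π ε (Nat.find hex) x := fun i hi => by
      have := Nat.find_min hex hi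
      by_contra h
      exact this ⟨by omega, h⟩
    refine ⟨Nat.find hex, h1, hn, ?_⟩
    have hI := iterate_iet_mem_Ico (π := π) hpos (x := x) ⟨hx, by linarith⟩ (Nat.find hex)
    obtain ⟨j, hj⟩ := exists_mem_block hI
    by_contra hno
    exact h2 ⟨j, hj, window_le_of_mem_block hj (hn.iterate_add_le_sum hpos hxε le_rfl)
      fun k hk hmem => hno ⟨k, hk, hmem⟩⟩
  have key : ∀ l ≤ N, ∃ y, 0 ≤ y ∧ y + ε ≤ ∑ i, lam i ∧ Travels lam π ε l y ∧
      (iet lam π)^[l] y = x := by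
    intro l
    induction l with
    | zero => intro _; exact ⟨x, hx, hxε, fun i hi => absurd hi (by omega), rfl⟩
    | succ l ih =>
      intro hl
      obtain ⟨y, hy, hyε, hTy, hyx⟩ := ih (by omega)
      obtain ⟨y', i, hi, hiε, rfl⟩ := exists_preimage_window (π := π) hpos hε hy hyε fun s hs => by
        set u := iet lam π (pre lam s) - y with hu
        have hu' : u ∈ Ico 0 ε := ⟨by linarith [hs.1], by linarith [hs.2]⟩
        have h1 : orbPt lam π s (n + (l + 1)) = (iet lam π)^[n] x + u := by
          rw [orbPt, Function.iterate_add_apply, Function.iterate_succ_apply,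
            show iet lam π (pre lam s) = y + u by rw [hu]; ring, hTy.iterate_add hpos hu' le_rfl,
            hyx, hn.iterate_add hpos hu' le_rfl]
        have h2 := hfar s j (n + (l + 1)) hj (by omega) (by omega)
        have h3 : |orbPt lam π s (n + (l + 1)) - pre lam j| < ε := by
          rw [h1, abs_lt]
          constructor
          · linarith [hβ.2, hu'.1]
          · linarith [hβ.1, hu'.2]
        linarith
      refine ⟨y', (block_subset hpos i hi).1, hiε.trans (pre_add_self_le_sum hpos i), ?_, ?_⟩
      · intro k hk
        cases k with
        | zero => exact ⟨i, hi, hiε⟩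
        | succ k =>
          rw [Function.iterate_succ_apply]
          exact hTy k (by omega)
      · rw [Function.iterate_succ_apply, hyx]
  obtain ⟨y, hy, hyε, hTy, hyx⟩ := key N le_rfl
  exact ⟨y, hy, hyε, hTy, Or.inr hyx⟩

end Towers

section Windows

variable {m : ℕ} {lam nu : Fin m → ℝ} {π : Equiv.Perm (Fin m)} {f : ℝ → ℂ}

/-- The unit complex number `exp(2πit)`. -/
def rot (t : ℝ) : ℂ := Complex.exp (2 * Real.pi * Complex.I * (t : ℂ))

lemma norm_rot (t : ℝ) : ‖rot t‖ = 1 := by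
  have := Complex.norm_exp_ofReal_mul_I (2 * Real.pi * t)
  rw [← this, rot]
  congr 2
  push_cast
  ring

lemma rot_ne_zero (t : ℝ) : rot t ≠ 0 := Complex.exp_ne_zero _

/-- Bounded measurable functions are interval integrable, as are their distances to constants. -/
lemma intervalIntegrable_norm_sub (hf : Measurable f) (hf1 : ∀ x, ‖f x‖ ≤ 1) {ψ : ℝ → ℂ}
    (hψ : Continuous ψ) (a b : ℝ) :
    IntervalIntegrable (fun x => ‖f x - ψ x‖) volume a b := by
  have h1 : IntervalIntegrable f volume a b :=
    (intervalIntegrable_const (c := (1 : ℝ))).mono_fun hf.aestronglyMeasurable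
      (Filter.Eventually.of_forall fun x => by simpa using hf1 x)
  exact (h1.sub (hψ.intervalIntegrable a b)).norm

/-- Transport of deviations from a constant along a window inside one block. -/
lemma integral_norm_sub_iet (hpos : ∀ j, 0 < lam j)
    (heq : ∀ᵐ x, x ∈ Ico 0 (∑ i, lam i) → f (iet lam π x) = phiFn lam nu x * f x)
    {x e : ℝ} {j : Fin m} (he : 0 ≤ e) (hx : pre lam j ≤ x) (hxe : x + e ≤ pre lam j + lam j)
    (a : ℂ) :
    ∫ y in (x + wvec lam π j)..(x + wvec lam π j + e), ‖f y - rot (nu j) * a‖ =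
      ∫ y in x..(x + e), ‖f y - a‖ := by
  rw [show x + wvec lam π j + e = x + e + wvec lam π j by ring,
    ← intervalIntegral.integral_comp_add_right (fun y => ‖f y - rot (nu j) * a‖)]
  refine intervalIntegral.integral_congr_ae ?_
  filter_upwards [heq, (countable_singleton (x + e)).ae_notMem volume] with y hy hne hmem
  rw [uIoc_of_le (by linarith)] at hmem
  have hne' : y ≠ x + e := hne
  have hyj : y ∈ block lam j :=
    ⟨hx.trans hmem.1.le, (lt_of_le_of_ne hmem.2 hne').trans_le hxe⟩
  have := hy (block_subset hpos j hyj)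
  rw [iet_of_mem hpos hyj, phiFn_of_mem hpos hyj] at this
  rw [this, ← rot, ← mul_sub, norm_mul, norm_rot, one_mul]

lemma exists_integral_le_iet_iff (hpos : ∀ j, 0 < lam j)
    (heq : ∀ᵐ x, x ∈ Ico 0 (∑ i, lam i) → f (iet lam π x) = phiFn lam nu x * f x)
    {x e : ℝ} {j : Fin m} (he : 0 ≤ e) (hx : x ∈ block lam j)
    (hxe : x + e ≤ pre lam j + lam j) (r : ℝ) :
    (∃ a, ∫ y in iet lam π x..(iet lam π x + e), ‖f y - a‖ ≤ r) ↔
      ∃ a, ∫ y in x..(x + e), ‖f y - a‖ ≤ r := by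
  rw [iet_of_mem hpos hx]
  constructor
  · rintro ⟨a, ha⟩
    refine ⟨(rot (nu j))⁻¹ * a, ?_⟩
    rwa [← integral_norm_sub_iet hpos heq he hx.1 hxe, mul_inv_cancel_left₀ (rot_ne_zero _)]
  · rintro ⟨a, ha⟩
    exact ⟨rot (nu j) * a, by rwa [integral_norm_sub_iet hpos heq he hx.1 hxe]⟩

/-- The deviations of `f` from a function over disjoint translated windows. -/
lemma sum_integral_windows_le {g : ℝ → ℝ} (hg : IntervalIntegrable g volume 0 (∑ i, lam i))
    (hg0 : ∀ x, 0 ≤ g x) {ε : ℝ} (hε : 0 < ε) {N : ℕ} (hN : 0 < N) {z : ℕ → ℝ}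
    (hz : ∀ i < N, 0 ≤ z i ∧ z i + ε ≤ ∑ i, lam i)
    (hsep : ∀ i < N, ∀ j < N, i < j → ε ≤ |z j - z i|) :
    ∑ i ∈ Finset.range N, ∫ y in z i..(z i + ε), g y ≤ ∫ y in 0..(∑ i, lam i), g y := by
  have hL : 0 ≤ ∑ i, lam i := by linarith [hz 0 hN]
  have hgi : IntegrableOn g (Ioc 0 (∑ i, lam i)) := by
    rwa [intervalIntegrable_iff_integrableOn_Ioc_of_le hL] at hg
  have hsub : ∀ i < N, Ioc (z i) (z i + ε) ⊆ Ioc 0 (∑ i, lam i) := fun i hi =>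
    Ioc_subset_Ioc (hz i hi).1 (hz i hi).2
  rw [intervalIntegral.integral_of_le hL]
  calc ∑ i ∈ Finset.range N, ∫ y in z i..(z i + ε), g y
      = ∑ i ∈ Finset.range N, ∫ y in Ioc (z i) (z i + ε), g y :=
        Finset.sum_congr rfl fun i _ => intervalIntegral.integral_of_le (by linarith)
    _ = ∫ y in ⋃ i ∈ Finset.range N, Ioc (z i) (z i + ε), g y := by
        rw [integral_biUnion_finset _ fun i _ => measurableSet_Ioc]
        · intro i hi j hj hij
          have hi : i < N := by simpa using hi
          have hj : j < N := by simpa using hj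
          have hsep' : ε ≤ |z j - z i| := by
            rcases lt_or_gt_of_ne hij with h | h
            · exact hsep i hi j hj h
            · rw [abs_sub_comm]; exact hsep j hj i hi h
          refine disjoint_left.2 fun y hy hy' => ?_
          rw [le_abs] at hsep'
          rcases hsep' with h | h
          · linarith [hy.2, hy'.1]
          · linarith [hy.1, hy'.2]
        · exact fun i hi => hgi.mono_set (hsub i (by simpa using hi))
    _ ≤ ∫ y in Ioc 0 (∑ i, lam i), g y :=
        setIntegral_mono_set hgi (Filter.Eventually.of_forall hg0)
          (iUnion₂_subset fun i hi => hsub i (by simpa using hi)).eventuallyLE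

/-- At arbitrarily small scales, `f` is nearly constant on every window. -/
lemma exists_scale (hm : 2 ≤ m) (hirr : PermIrreducible π) (hpos : ∀ j, 0 < lam j) {c : ℝ}
    (hc : 0 < c) (hfar : ∃ᶠ M : ℕ in Filter.atTop, FarOrbits lam π M (c / (M + 1)))
    (hf : Measurable f) (hf1 : ∀ x, ‖f x‖ ≤ 1)
    (heq : ∀ᵐ x, x ∈ Ico 0 (∑ i, lam i) → f (iet lam π x) = phiFn lam nu x * f x)
    {η ε₁ : ℝ} (hη : 0 < η) (hε₁ : 0 < ε₁) :
    ∃ ε, 0 < ε ∧ ε < ε₁ ∧ ∀ x, 0 ≤ x → x + ε ≤ ∑ i, lam i →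
      ∃ a, ∫ y in x..(x + ε), ‖f y - a‖ ≤ η * ε := by
  have hL : 0 ≤ ∑ i, lam i := Finset.sum_nonneg fun i _ => (hpos i).le
  have hint : Integrable ((Ioc 0 (∑ i, lam i)).indicator f) := by
    rw [integrable_indicator_iff measurableSet_Ioc]
    exact Integrable.of_bound hf.aestronglyMeasurable 1 (Filter.Eventually.of_forall hf1)
  obtain ⟨ψ, hψsupp, hψ, hψc, -⟩ := hint.exists_hasCompactSupport_integral_sub_le
    (ε := η * c / 12) (by positivity)
  have hψint : ∫ y in 0..(∑ i, lam i), ‖f y - ψ y‖ ≤ η * c / 12 := by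
    rw [intervalIntegral.integral_of_le hL]
    refine le_trans ?_ hψ
    rw [setIntegral_congr_fun (g := fun y => ‖(Ioc 0 (∑ i, lam i)).indicator f y - ψ y‖)
      measurableSet_Ioc fun y hy => by simp only [indicator_of_mem hy]]
    exact setIntegral_le_integral
      ((hint.sub (hψc.integrable_of_hasCompactSupport hψsupp)).norm)
      (Filter.Eventually.of_forall fun _ => norm_nonneg _)
  obtain ⟨d, hd, hψd⟩ := Metric.uniformContinuous_iff.1
    (hψsupp.uniformContinuous_of_continuous hψc) (η / 2) (by positivity)
  have hlim : Filter.Tendsto (fun M : ℕ => c / ((M : ℝ) + 1)) Filter.atTop (nhds 0) :=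
    tendsto_const_div_atTop_nhds_zero_nat c |>.comp (Filter.tendsto_add_atTop_nat 1) |>.congr
      fun M => by simp
  have hev : ∀ᶠ M : ℕ in Filter.atTop, c / ((M : ℝ) + 1) < ε₁ ∧ c / ((M : ℝ) + 1) < d ∧
      (∀ j, c / ((M : ℝ) + 1) < lam j) ∧ 2 ≤ M :=
    (hlim.eventually (gt_mem_nhds hε₁)).and ((hlim.eventually (gt_mem_nhds hd)).and
      ((Filter.eventually_all.2 fun j => hlim.eventually (gt_mem_nhds (hpos j))).and
        (Filter.eventually_ge_atTop 2)))
  obtain ⟨M, hM, hM1, hMd, hMlam, hM2⟩ := (hfar.and_eventually hev).exists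
  set ε := c / ((M : ℝ) + 1) with hε_def
  have hε : 0 < ε := by positivity
  refine ⟨ε, hε, hM1, fun x hx hxε => ?_⟩
  set N := M / 2 with hN
  have hNpos : 0 < N := by omega
  obtain ⟨y, hy, hyε, hT, hyx⟩ := exists_travels (π := π) (N := N) hpos hε
    (fun s j k hj hk hkM => hM s j k hj hk (by omega)) hx hxε
  have hyI : y ∈ Ico 0 (∑ i, lam i) := ⟨hy, by linarith⟩
  have hsum := sum_integral_windows_le (lam := lam) (N := N) (z := fun i => (iet lam π)^[i] y)
    (intervalIntegrable_norm_sub hf hf1 hψc 0 _) (fun _ => norm_nonneg _) hε hNpos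
    (fun i hi => ⟨(iterate_iet_mem_Ico hpos hyI i).1, hT.iterate_add_le_sum hpos hyε hi.le⟩)
    (fun i hi j hj hij => by
      have := le_abs_iterate_sub_self hm hirr hpos hM (fun j => (hMlam j).le) (p := j - i)
        (by omega) (by omega) (iterate_iet_mem_Ico (π := π) hpos hyI i)
      rwa [← Function.iterate_add_apply, Nat.sub_add_cancel hij.le] at this)
  obtain ⟨i, hi, hi_le⟩ : ∃ i ∈ Finset.range N,
      ∫ u in (iet lam π)^[i] y..((iet lam π)^[i] y + ε), ‖f u - ψ u‖ ≤ η * c / 12 / N := by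
    refine Finset.exists_le_of_sum_le ⟨0, by simpa using hNpos⟩ ((hsum.trans hψint).trans ?_)
    rw [Finset.sum_const, Finset.card_range, nsmul_eq_mul]
    have : (N : ℝ) ≠ 0 := by positivity
    rw [mul_div_cancel₀ _ this]
  have hi : i < N := by simpa using hi
  have hNM : η * c / 12 / N ≤ η / 2 * ε := by
    have h1 : M ≤ 2 * N + 1 := by omega
    have h2 : ((M : ℝ) + 1) ≤ 6 * N := by exact_mod_cast (by omega : M + 1 ≤ 6 * N)
    have h3 : (0 : ℝ) < N := by positivity
    rw [hε_def, div_le_iff₀ h3, mul_div_assoc', div_mul_eq_mul_div, le_div_iff₀ (by positivity)]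
    have := mul_le_mul_of_nonneg_left h2 (by positivity : 0 ≤ η * c / 12)
    linarith
  have key : ∀ k ≤ N, (∃ a, ∫ u in (iet lam π)^[k] y..((iet lam π)^[k] y + ε), ‖f u - a‖ ≤ η * ε) ↔
      ∃ a, ∫ u in y..(y + ε), ‖f u - a‖ ≤ η * ε := by
    intro k
    induction k with
    | zero => intro _; rfl
    | succ k ih =>
      intro hk
      obtain ⟨j, h1, h2⟩ := hT k (by omega)
      rw [Function.iterate_succ_apply', exists_integral_le_iet_iff hpos heq hε.le h1 h2,
        ih (by omega)]
  have hQ : ∃ a, ∫ u in (iet lam π)^[i] y..((iet lam π)^[i] y + ε), ‖f u - a‖ ≤ η * ε := by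
    set z := (iet lam π)^[i] y with hz
    refine ⟨ψ z, ?_⟩
    have hle : z ≤ z + ε := by linarith
    calc ∫ u in z..(z + ε), ‖f u - ψ z‖
        ≤ ∫ u in z..(z + ε), (‖f u - ψ u‖ + η / 2) := by
          refine intervalIntegral.integral_mono_on hle
            (intervalIntegrable_norm_sub hf hf1 continuous_const _ _)
            ((intervalIntegrable_norm_sub hf hf1 hψc _ _).add intervalIntegrable_const)
            fun u hu => ?_
          have h1 : dist u z < d := by
            rw [Real.dist_eq, abs_of_nonneg (by linarith [hu.1])]
            linarith [hu.2]
          have h2 := (hψd h1).le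
          rw [dist_eq_norm] at h2
          calc ‖f u - ψ z‖ = ‖(f u - ψ u) + (ψ u - ψ z)‖ := by rw [sub_add_sub_cancel]
            _ ≤ _ := (norm_add_le _ _).trans (by linarith)
      _ = (∫ u in z..(z + ε), ‖f u - ψ u‖) + η / 2 * ε := by
          rw [intervalIntegral.integral_add (intervalIntegrable_norm_sub hf hf1 hψc _ _)
            intervalIntegrable_const, intervalIntegral.integral_const, add_sub_cancel_left,
            smul_eq_mul, mul_comm ε]
      _ ≤ η * ε := by linarith
  have hy0 := (key i hi.le).1 hQ
  rcases hyx with rfl | rfl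
  · exact hy0
  · exact (key N le_rfl).2 hy0

end Windows

section Amplitude

/-- A `{0,1}`-valued function close to a constant on every window of length `ε`
is close to `1` on every such window, as soon as its integral is not too small. -/
lemma le_integral_window_of_near_const {u : ℝ → ℝ} (hu : ∀ x, u x = 0 ∨ u x = 1)
    (hi : ∀ a b, IntervalIntegrable u volume a b) {L ε η : ℝ} (hε : 0 < ε) (hεL : ε ≤ L)
    (hε1 : ε ≤ 1) (hη : 0 < η) (hη8 : η < 1 / 8)
    (hP : 2 * η * (L + 1) < ∫ y in 0..L, u y)
    (hr : ∀ x, 0 ≤ x → x + ε ≤ L → ∃ r : ℝ, ∫ y in x..(x + ε), |u y - r| ≤ η * ε)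
    {x : ℝ} (hx : 0 ≤ x) (hxε : x + ε ≤ L) :
    (1 - 2 * η) * ε ≤ ∫ y in x..(x + ε), u y := by
  have hdich : ∀ x, 0 ≤ x → x + ε ≤ L → (∫ y in x..(x + ε), u y) ≤ 2 * η * ε ∨
      (1 - 2 * η) * ε ≤ ∫ y in x..(x + ε), u y := by
    intro x hx hxε
    obtain ⟨r, hr⟩ := hr x hx hxε
    have hle : x ≤ x + ε := by linarith
    have hir : IntervalIntegrable (fun y => |u y - r|) volume x (x + ε) :=
      ((hi _ _).sub intervalIntegrable_const).abs
    rcases le_total r (1 / 2) with h | h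
    · left
      have : ∫ y in x..(x + ε), u y ≤ ∫ y in x..(x + ε), 2 * |u y - r| := by
        refine intervalIntegral.integral_mono_on hle (hi _ _) (hir.const_mul 2) fun y _ => ?_
        rcases hu y with h0 | h0 <;> rw [h0]
        · positivity
        · linarith [le_abs_self (1 - r)]
      rw [intervalIntegral.integral_const_mul] at this
      linarith
    · right
      have : ∫ y in x..(x + ε), (1 - u y) ≤ ∫ y in x..(x + ε), 2 * |u y - r| := by
        refine intervalIntegral.integral_mono_on hle (intervalIntegrable_const.sub (hi _ _))
          (hir.const_mul 2) fun y _ => ?_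
        rcases hu y with h0 | h0 <;> rw [h0]
        · linarith [neg_abs_le (0 - r)]
        · linarith [abs_nonneg (1 - r)]
      rw [intervalIntegral.integral_const_mul, intervalIntegral.integral_sub
        intervalIntegrable_const (hi _ _), intervalIntegral.integral_const,
        add_sub_cancel_left, smul_eq_mul] at this
      linarith
  by_contra hlt
  have hx2 := (hdich x hx hxε).resolve_right hlt
  have hcont : Continuous fun x => ∫ y in x..(x + ε), u y := by
    have hF := intervalIntegral.continuous_primitive hi 0
    have : (fun x => ∫ y in x..(x + ε), u y) =
        fun x => (∫ y in 0..(x + ε), u y) - ∫ y in 0..x, u y := by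
      funext x
      rw [intervalIntegral.integral_interval_sub_left (hi _ _) (hi _ _)]
    rw [this]
    exact (hF.comp (continuous_id.add continuous_const)).sub hF
  have hsmall : ∀ z, 0 ≤ z → z + ε ≤ L → (∫ y in z..(z + ε), u y) ≤ 2 * η * ε := by
    intro z hz hzε
    by_contra hz2
    have hz1 := (hdich z hz hzε).resolve_left hz2
    have hmem : ε / 2 ∈ Icc (∫ y in x..(x + ε), u y) (∫ y in z..(z + ε), u y) :=
      ⟨by nlinarith, by nlinarith⟩
    obtain ⟨t, ht, hteq⟩ := (isPreconnected_Icc (a := (0 : ℝ)) (b := L - ε)).intermediate_value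
      ⟨hx, by linarith⟩ ⟨hz, by linarith⟩ hcont.continuousOn hmem
    rcases hdich t ht.1 (by linarith [ht.2]) with h | h <;>
      (simp only at hteq; rw [hteq] at h; nlinarith)
  have hind : ∀ n : ℕ, n * ε ≤ L → ∫ y in 0..(n * ε), u y ≤ n * (2 * η * ε) := by
    intro n
    induction n with
    | zero => simp
    | succ n ih =>
      intro hn
      push_cast at hn ⊢
      rw [add_one_mul] at hn ⊢
      have h0 : (0 : ℝ) ≤ n * ε := by positivity
      rw [← intervalIntegral.integral_add_adjacent_intervals (hi 0 (n * ε)) (hi _ _)]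
      linarith [ih (by linarith), hsmall (n * ε) h0 hn]
  have hL : 0 < L := hε.trans_le hεL
  set n := ⌊L / ε⌋₊ with hn
  have h1 : n * ε ≤ L := by
    rw [← le_div_iff₀ hε]
    exact Nat.floor_le (by positivity)
  have h2 : L < (n + 1) * ε := by
    rw [← div_lt_iff₀ hε]
    exact Nat.lt_floor_add_one _
  have h3 : ∫ y in (n * ε)..L, u y ≤ ∫ y in (L - ε)..L, u y := by
    rw [← intervalIntegral.integral_add_adjacent_intervals (hi (L - ε) (n * ε)) (hi _ L)]
    have : 0 ≤ ∫ y in (L - ε)..(n * ε), u y :=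
      intervalIntegral.integral_nonneg (by linarith) fun y _ => by
        rcases hu y with h | h <;> norm_num [h]
    linarith
  have h4 := hsmall (L - ε) (by linarith) (by linarith)
  rw [sub_add_cancel] at h4
  have h5 := hind n h1
  rw [← intervalIntegral.integral_add_adjacent_intervals (hi 0 (n * ε)) (hi _ L)] at hP
  nlinarith

variable {m : ℕ} {lam nu : Fin m → ℝ} {π : Equiv.Perm (Fin m)} {f : ℝ → ℂ}

/-- At arbitrarily small scales, `f` is nearly a unimodular constant on every window. -/
lemma exists_unimodular_scale (hm : 2 ≤ m) (hirr : PermIrreducible π) (hpos : ∀ j, 0 < lam j)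
    {c : ℝ} (hc : 0 < c) (hfar : ∃ᶠ M : ℕ in Filter.atTop, FarOrbits lam π M (c / (M + 1)))
    (hf : Measurable f) (hf1 : ∀ x, ‖f x‖ = 0 ∨ ‖f x‖ = 1)
    (hP : 0 < ∫ y in 0..(∑ i, lam i), ‖f y‖)
    (heq : ∀ᵐ x, x ∈ Ico 0 (∑ i, lam i) → f (iet lam π x) = phiFn lam nu x * f x)
    {η ε₁ : ℝ} (hη : 0 < η) (hε₁ : 0 < ε₁) :
    ∃ ε, 0 < ε ∧ ε < ε₁ ∧ ∀ x, 0 ≤ x → x + ε ≤ ∑ i, lam i →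
      ∃ a, ∫ y in x..(x + ε), ‖f y - a‖ ≤ η * ε ∧ |‖a‖ - 1| ≤ 3 * η := by
  set L := ∑ i, lam i with hLdef
  have hL : 0 < L := Finset.sum_pos (fun i _ => hpos i) ⟨⟨0, by omega⟩, Finset.mem_univ _⟩
  have hf1' : ∀ x, ‖f x‖ ≤ 1 := fun x => by rcases hf1 x with h | h <;> rw [h]; norm_num
  set P := ∫ y in 0..L, ‖f y‖ with hPdef
  obtain ⟨θ, hθ, hθη, hθ8, hθP⟩ : ∃ θ, 0 < θ ∧ θ ≤ η ∧ θ < 1 / 8 ∧ 2 * θ * (L + 1) < P := by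
    refine ⟨min η (min (1 / 9) (P / (3 * (L + 1)))), by positivity, min_le_left _ _,
      ((min_le_right _ _).trans (min_le_left _ _)).trans_lt (by norm_num), ?_⟩
    have h := (min_le_right η _).trans (min_le_right (1 / 9) (P / (3 * (L + 1))))
    rw [le_div_iff₀ (by positivity)] at h
    nlinarith
  obtain ⟨ε, hε, hεlt, hwin⟩ := exists_scale hm hirr hpos hc hfar hf hf1' heq hθ
    (lt_min hε₁ (lt_min one_pos hL))
  have hε1 : ε < 1 := hεlt.trans_le ((min_le_right _ _).trans (min_le_left _ _))
  have hεL : ε < L := hεlt.trans_le ((min_le_right _ _).trans (min_le_right _ _))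
  have hint : ∀ (a : ℂ) (s t : ℝ), IntervalIntegrable (fun y => ‖f y - a‖) volume s t :=
    fun a s t => intervalIntegrable_norm_sub hf hf1' continuous_const s t
  have hi : ∀ s t : ℝ, IntervalIntegrable (fun y => ‖f y‖) volume s t := fun s t => by
    simpa using hint 0 s t
  refine ⟨ε, hε, hεlt.trans_le (min_le_left _ _), fun x hx hxε => ?_⟩
  obtain ⟨a, ha⟩ := hwin x hx hxε
  refine ⟨a, ha.trans (by gcongr), ?_⟩
  have hle : x ≤ x + ε := by linarith
  have hbig := le_integral_window_of_near_const hf1 hi hε hεL.le hε1.le hθ hθ8 hθP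
    (fun x hx hxε => by
      obtain ⟨a, ha⟩ := hwin x hx hxε
      refine ⟨‖a‖, le_trans ?_ ha⟩
      exact intervalIntegral.integral_mono_on (by linarith)
        (((hi _ _).sub intervalIntegrable_const).abs) (hint a _ _)
        fun y _ => abs_norm_sub_norm_le _ _) hx hxε
  have hfin : ∫ y in x..(x + ε), |‖a‖ - 1| ≤ ∫ y in x..(x + ε), (‖f y - a‖ + (1 - ‖f y‖)) := by
    refine intervalIntegral.integral_mono_on hle intervalIntegrable_const
      ((hint a _ _).add (intervalIntegrable_const.sub (hi _ _))) fun y _ => ?_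
    have h1 := abs_norm_sub_norm_le (f y) a
    have h2 := hf1' y
    rw [abs_le] at h1 ⊢
    constructor <;> linarith [h1.1, h1.2]
  rw [intervalIntegral.integral_add (hint a _ _) (intervalIntegrable_const.sub (hi _ _)),
    intervalIntegral.integral_sub intervalIntegrable_const (hi _ _),
    intervalIntegral.integral_const, intervalIntegral.integral_const,
    add_sub_cancel_left, smul_eq_mul, smul_eq_mul] at hfin
  have : ε * |‖a‖ - 1| ≤ ε * (3 * θ) := by linarith
  linarith [le_of_mul_le_mul_left this hε]

lemma norm_sub_mul_le_of_integral_le (hf : Measurable f) (hf1 : ∀ x, ‖f x‖ ≤ 1) {x e r : ℝ}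
    (he : 0 ≤ e) {a b : ℂ} (ha : ∫ y in x..(x + e), ‖f y - a‖ ≤ r)
    (hb : ∫ y in x..(x + e), ‖f y - b‖ ≤ r) : e * ‖a - b‖ ≤ 2 * r := by
  have hint : ∀ a : ℂ, IntervalIntegrable (fun y => ‖f y - a‖) volume x (x + e) :=
    fun a => intervalIntegrable_norm_sub hf hf1 continuous_const _ _
  have h : ∫ y in x..(x + e), ‖a - b‖ ≤ ∫ y in x..(x + e), (‖f y - a‖ + ‖f y - b‖) := by
    refine intervalIntegral.integral_mono_on (by linarith) intervalIntegrable_const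
      ((hint a).add (hint b)) fun y _ => ?_
    rw [norm_sub_rev (f y) a]
    exact norm_sub_le_norm_sub_add_norm_sub a (f y) b
  rw [intervalIntegral.integral_add (hint a) (hint b), intervalIntegral.integral_const,
    add_sub_cancel_left, smul_eq_mul] at h
  linarith

/-- Approximate values of `f` at the endpoints of both partitions. -/
lemma exists_approx_boundary_values (hm : 2 ≤ m) (hirr : PermIrreducible π)
    (hpos : ∀ j, 0 < lam j) {c : ℝ} (hc : 0 < c)
    (hfar : ∃ᶠ M : ℕ in Filter.atTop, FarOrbits lam π M (c / (M + 1)))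
    (hf : Measurable f) (hf1 : ∀ x, ‖f x‖ = 0 ∨ ‖f x‖ = 1)
    (hP : 0 < ∫ y in 0..(∑ i, lam i), ‖f y‖)
    (heq : ∀ᵐ x, x ∈ Ico 0 (∑ i, lam i) → f (iet lam π x) = phiFn lam nu x * f x)
    {η : ℝ} (hη : 0 < η) :
    ∃ A : ℝ → ℂ, (∀ p, |‖A p‖ - 1| ≤ 3 * η) ∧ ∀ j,
      ‖rot (nu j) * A (pre lam j) - A (pre (permLam lam π) (π j))‖ ≤ 4 * η ∧
      ‖rot (nu j) * A (pre lam j + lam j) -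
        A (pre (permLam lam π) (π j) + permLam lam π (π j))‖ ≤ 4 * η := by
  have : Nonempty (Fin m) := ⟨⟨0, by omega⟩⟩
  obtain ⟨j₀, hj₀⟩ := Finite.exists_min lam
  obtain ⟨ε, hε, hεlt, hwin⟩ := exists_unimodular_scale hm hirr hpos hc hfar hf hf1 hP heq hη
    (hpos j₀)
  have hεlam : ∀ j, ε < lam j := fun j => hεlt.trans_le (hj₀ j)
  have hf1' : ∀ x, ‖f x‖ ≤ 1 := fun x => by rcases hf1 x with h | h <;> rw [h]; norm_num
  set L := ∑ i, lam i with hLdef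
  have hεL : ε < L :=
    (hεlam j₀).trans_le (Finset.single_le_sum (fun i _ => (hpos i).le) (Finset.mem_univ j₀))
  have hint : ∀ (a : ℂ) (s t : ℝ), IntervalIntegrable (fun y => ‖f y - a‖) volume s t :=
    fun a s t => intervalIntegrable_norm_sub hf hf1' continuous_const s t
  have hA : ∀ p : ℝ, ∃ a : ℂ, |‖a‖ - 1| ≤ 3 * η ∧ ∀ s, 0 ≤ s → s + ε / 2 ≤ L →
      s = p ∨ s + ε / 2 = p → ∫ y in s..(s + ε / 2), ‖f y - a‖ ≤ η * ε := by
    intro p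
    have h1 : max 0 (min (p - ε / 2) (L - ε)) ≤ L - ε :=
      max_le (by linarith) (min_le_right _ _)
    obtain ⟨a, ha, ha'⟩ := hwin _ (le_max_left 0 (min (p - ε / 2) (L - ε))) (by linarith)
    refine ⟨a, ha', fun s hs hsε hsp => le_trans ?_ ha⟩
    refine intervalIntegral.integral_mono_interval ?_ (by linarith) ?_
      (Filter.Eventually.of_forall fun _ => norm_nonneg _) (hint a _ _)
    · refine max_le hs ?_
      rcases hsp with h | h
      · exact (min_le_left _ _).trans (by linarith)
      · exact (min_le_left _ _).trans (by linarith)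
    · have h2 : min (p - ε / 2) (L - ε) ≤ max 0 (min (p - ε / 2) (L - ε)) := le_max_right _ _
      have h3 : s - ε / 2 ≤ min (p - ε / 2) (L - ε) :=
        le_min (by rcases hsp with h | h <;> linarith) (by linarith)
      linarith
  choose A hA1 hA2 using hA
  refine ⟨A, hA1, fun j => ?_⟩
  have hle := hεlam j
  have h0 := pre_nonneg hpos j
  have hsum := pre_add_self_le_sum hpos j
  have h0' := pre_nonneg (permLam_pos (π := π) hpos) (π j)
  have hsum' := pre_add_self_le_sum (permLam_pos (π := π) hpos) (π j)
  rw [sum_permLam, permLam_apply, ← hLdef] at hsum'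
  rw [← hLdef] at hsum
  have hshift := pre_permLam lam π j
  have close : ∀ s p q, pre lam j ≤ s → s + ε / 2 ≤ pre lam j + lam j →
      (s = p ∨ s + ε / 2 = p) → q = p + wvec lam π j → ‖rot (nu j) * A p - A q‖ ≤ 4 * η := by
    intro s p q hs hsε hsp hq
    have ha := hA2 p s (by linarith) (by linarith) hsp
    rw [← integral_norm_sub_iet (π := π) hpos heq (by linarith) hs hsε] at ha
    have hb := hA2 q (s + wvec lam π j) (by linarith) (by linarith)
      (by rcases hsp with h | h <;> [left; right] <;> linarith)
    have := norm_sub_mul_le_of_integral_le hf hf1' (by linarith) ha hb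
    have h2 : ε / 2 * ‖rot (nu j) * A p - A q‖ ≤ ε / 2 * (4 * η) := by linarith
    exact le_of_mul_le_mul_left h2 (by linarith)
  constructor
  · exact close (pre lam j) _ _ le_rfl (by linarith) (Or.inl rfl) hshift
  · refine close (pre lam j + lam j - ε / 2) _ _ (by linarith) (by linarith)
      (Or.inr (by ring)) ?_
    rw [permLam_apply, hshift]
    ring

/-- Exact unimodular boundary values, obtained in the limit. -/
lemma exists_boundary_values (hm : 2 ≤ m) (hirr : PermIrreducible π)
    (hpos : ∀ j, 0 < lam j) {c : ℝ} (hc : 0 < c)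
    (hfar : ∃ᶠ M : ℕ in Filter.atTop, FarOrbits lam π M (c / (M + 1)))
    (hf : Measurable f) (hf1 : ∀ x, ‖f x‖ = 0 ∨ ‖f x‖ = 1)
    (hP : 0 < ∫ y in 0..(∑ i, lam i), ‖f y‖)
    (heq : ∀ᵐ x, x ∈ Ico 0 (∑ i, lam i) → f (iet lam π x) = phiFn lam nu x * f x) :
    ∃ A : ℝ → ℂ, (∀ p, ‖A p‖ = 1) ∧ ∀ j,
      rot (nu j) * A (pre lam j) = A (pre (permLam lam π) (π j)) ∧
      rot (nu j) * A (pre lam j + lam j) =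
        A (pre (permLam lam π) (π j) + permLam lam π (π j)) := by
  choose A hA1 hA2 using fun n : ℕ => exists_approx_boundary_values hm hirr hpos hc hfar hf hf1
    hP heq (Nat.one_div_pos_of_nat (α := ℝ) (n := n))
  have hη : Filter.Tendsto (fun n : ℕ => 1 / ((n : ℝ) + 1)) (Filter.hyperfilter ℕ) (nhds 0) :=
    tendsto_one_div_add_atTop_nhds_zero_nat.mono_left
      (by rw [← Nat.cofinite_eq_atTop]; exact Filter.hyperfilter_le_cofinite)
  have hlim : ∀ p, ∃ a : ℂ, Filter.Tendsto (fun n => A n p) (Filter.hyperfilter ℕ) (nhds a) := by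
    intro p
    have hmem : ∀ n, A n p ∈ Metric.closedBall (0 : ℂ) 4 := by
      intro n
      rw [mem_closedBall_zero_iff]
      have h1 := (abs_le.1 (hA1 n p)).2
      have h2 : 1 / ((n : ℝ) + 1) ≤ 1 := by
        rw [div_le_one (by positivity)]
        linarith [n.cast_nonneg (α := ℝ)]
      linarith
    obtain ⟨a, -, ha⟩ := (isCompact_closedBall (0 : ℂ) 4).ultrafilter_le_nhds
      ((Filter.hyperfilter ℕ).map fun n => A n p)
      (Filter.le_principal_iff.2 (Ultrafilter.mem_map.2 (Filter.univ_mem' hmem)))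
    exact ⟨a, ha⟩
  choose B hB using hlim
  have hzero : ∀ {g : ℕ → ℝ} {r : ℝ} (k : ℝ), (∀ n : ℕ, g n ≤ k * (1 / ((n : ℝ) + 1))) →
      Filter.Tendsto g (Filter.hyperfilter ℕ) (nhds r) → r ≤ 0 := by
    intro g r k hg hr
    have := hη.const_mul k
    rw [mul_zero] at this
    exact le_of_tendsto_of_tendsto' hr this hg
  refine ⟨B, fun p => ?_, fun j => ⟨?_, ?_⟩⟩
  · have := hzero 3 (fun n => hA1 n p) (((hB p).norm.sub_const 1).abs)
    linarith [abs_nonpos_iff.1 this]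
  · have := hzero 4 (fun n => (hA2 n j).1) ((((hB _).const_mul _).sub (hB _)).norm)
    exact sub_eq_zero.1 (norm_le_zero_iff.1 this)
  · have := hzero 4 (fun n => (hA2 n j).2) ((((hB _).const_mul _).sub (hB _)).norm)
    exact sub_eq_zero.1 (norm_le_zero_iff.1 this)

end Amplitude

section Orbits

variable {m : ℕ} {π : Equiv.Perm (Fin m)} {nu : Fin m → ℝ}

lemma piExt_piExtInv (k : ℕ) : piExt π (piExtInv π k) = k := by
  by_cases h : 1 ≤ k ∧ k ≤ m
  · have h2 : 1 ≤ (π.symm ⟨k - 1, by omega⟩ : ℕ) + 1 ∧ (π.symm ⟨k - 1, by omega⟩ : ℕ) + 1 ≤ m :=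
      ⟨by omega, (π.symm _).isLt⟩
    simp only [piExtInv, dif_pos h, piExt, dif_pos h2, Nat.add_sub_cancel, Fin.eta,
      Equiv.apply_symm_apply]
    omega
  · simp only [piExtInv, dif_neg h, piExt]

lemma piExtInv_piExt (k : ℕ) : piExtInv π (piExt π k) = k := by
  by_cases h : 1 ≤ k ∧ k ≤ m
  · have h2 : 1 ≤ (π ⟨k - 1, by omega⟩ : ℕ) + 1 ∧ (π ⟨k - 1, by omega⟩ : ℕ) + 1 ≤ m :=
      ⟨by omega, (π _).isLt⟩
    simp only [piExt, dif_pos h, piExtInv, dif_pos h2, Nat.add_sub_cancel, Fin.eta,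
      Equiv.symm_apply_apply]
    omega
  · simp only [piExtInv, dif_neg h, piExt]

lemma piExt_le {s : ℕ} (hs : s ≤ m) : piExt π s ≤ m := by
  unfold piExt
  split_ifs with h
  · exact (π _).isLt
  · exact hs

lemma piExtInv_pos {k : ℕ} (hk : 1 ≤ k) : 1 ≤ piExtInv π k := by
  unfold piExtInv
  split_ifs with h
  · omega
  · exact hk

lemma piExtInv_le {k : ℕ} (hk : k ≤ m + 1) : piExtInv π k ≤ m + 1 := by
  unfold piExtInv
  split_ifs with h
  · have := (π.symm ⟨k - 1, by omega⟩).isLt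
    omega
  · exact hk

lemma sigmaPi_add_one (s : ℕ) : sigmaPi π s + 1 = piExtInv π (piExt π s + 1) :=
  Nat.sub_add_cancel (piExtInv_pos (by omega))

lemma sigmaPi_le {s : ℕ} (hs : s ≤ m) : sigmaPi π s ≤ m := by
  have h1 := sigmaPi_add_one (π := π) s
  have h2 := piExtInv_le (π := π) (Nat.succ_le_succ (piExt_le (π := π) hs))
  simp only [Nat.succ_eq_add_one] at h2
  omega

lemma sigmaPi_injective : Function.Injective (sigmaPi π) := by
  intro s t hst
  have h : piExtInv π (piExt π s + 1) = piExtInv π (piExt π t + 1) := by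
    rw [← sigmaPi_add_one, ← sigmaPi_add_one, hst]
  have h2 := congrArg (piExt π) h
  rw [piExt_piExtInv, piExt_piExtInv] at h2
  have h3 := congrArg (piExtInv π) (Nat.succ_injective h2)
  rwa [piExtInv_piExt, piExtInv_piExt] at h3

lemma image_sigmaPi_orbitOf (i : ℕ) : (orbitOf π i).image (sigmaPi π) = orbitOf π i := by
  refine Finset.eq_of_subset_of_card_le ?_
    (Finset.card_image_of_injective _ sigmaPi_injective).ge
  intro t ht
  obtain ⟨s, hs, rfl⟩ := Finset.mem_image.1 ht
  obtain ⟨hsm, n, hn⟩ := Finset.mem_filter.1 hs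
  refine Finset.mem_filter.2 ⟨Finset.mem_Iic.2 (sigmaPi_le (Finset.mem_Iic.1 hsm)), n + 1, ?_⟩
  rw [Function.iterate_succ_apply', hn]

lemma prod_comp_sigmaPi (g : ℕ → ℂ) (i : ℕ) :
    ∏ s ∈ orbitOf π i, g (sigmaPi π s) = ∏ s ∈ orbitOf π i, g s := by
  conv_rhs => rw [← image_sigmaPi_orbitOf i, Finset.prod_image sigmaPi_injective.injOn]

/-- The vector `ν`, indexed from `1` and extended by zero. -/
def nuExt (nu : Fin m → ℝ) (s : ℕ) : ℝ :=
  if h : 1 ≤ s ∧ s ≤ m then nu ⟨s - 1, by omega⟩ else 0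

lemma nuExt_succ (j : Fin m) : nuExt nu (j + 1) = nu j := by
  have h : 1 ≤ (j : ℕ) + 1 ∧ (j : ℕ) + 1 ≤ m := ⟨by omega, j.isLt⟩
  simp only [nuExt, dif_pos h, Nat.add_sub_cancel, Fin.eta]

lemma sum_bvec_mul {S : Finset ℕ} (hS : S ⊆ Finset.range (m + 1)) :
    ∑ i : Fin m, (bvec S i : ℝ) * nu i = ∑ s ∈ S, nuExt nu (s + 1) - ∑ s ∈ S, nuExt nu s := by
  have h1 : ∀ g : ℕ → ℝ, ∑ s ∈ S, g s = ∑ s ∈ Finset.range (m + 1), if s ∈ S then g s else 0 := by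
    intro g
    rw [← Finset.sum_filter, Finset.filter_mem_eq_inter, Finset.inter_eq_right.2 hS]
  rw [h1, h1 (nuExt nu), Finset.sum_range_succ, Finset.sum_range_succ' (fun s => if s ∈ S then
    nuExt nu s else 0)]
  have hz : nuExt nu (m + 1) = 0 := by simp [nuExt]
  have hz' : nuExt nu 0 = 0 := by simp [nuExt]
  rw [hz, hz', ite_self, ite_self, add_zero, add_zero, ← Finset.sum_sub_distrib,
    Finset.sum_range]
  refine Finset.sum_congr rfl fun i _ => ?_
  rw [nuExt_succ, bvec]
  split_ifs <;> simp

lemma rot_zero : rot 0 = 1 := by simp [rot]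

lemma rot_sum (S : Finset ℕ) (g : ℕ → ℝ) : rot (∑ s ∈ S, g s) = ∏ s ∈ S, rot (g s) := by
  simp only [rot]
  rw [Complex.ofReal_sum, Finset.mul_sum, Complex.exp_sum]

lemma exists_int_of_rot_eq {s t : ℝ} (h : rot s = rot t) : ∃ z : ℤ, s - t = z := by
  rw [rot, rot, Complex.exp_eq_exp_iff_exists_int] at h
  obtain ⟨n, hn⟩ := h
  refine ⟨n, ?_⟩
  have h0 : (2 * Real.pi * Complex.I : ℂ) ≠ 0 := Complex.two_pi_I_ne_zero
  have h1 : (s : ℂ) = t + n := mul_left_cancel₀ h0 (by rw [hn]; ring)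
  have h2 : s = t + n := by exact_mod_cast h1
  linarith

/-- Compatible endpoint values on both partitions force integrality along orbits. -/
lemma exists_int_of_boundary_values {a b : ℕ → ℂ} (ha : ∀ s, a s ≠ 0) (h0 : a 0 = b 0)
    (hm : a m = b m)
    (hl : ∀ j : Fin m, rot (nu j) * a j = b (π j))
    (hr : ∀ j : Fin m, rot (nu j) * a (j + 1) = b (π j + 1)) {S : Finset ℕ}
    (hS : S ∈ orbitsOf π) : ∃ z : ℤ, ∑ i : Fin m, (bvec S i : ℝ) * nu i = (z : ℝ) := by
  obtain ⟨i, -, rfl⟩ := Finset.mem_image.1 hS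
  have hright : ∀ s ≤ m, b (piExt π s) = rot (nuExt nu s) * a s := by
    intro s hs
    by_cases h : 1 ≤ s ∧ s ≤ m
    · have := hr ⟨s - 1, by omega⟩
      simp only [Nat.sub_add_cancel h.1] at this
      simp only [piExt, nuExt, dif_pos h, this]
    · obtain rfl : s = 0 := by omega
      simp [piExt, nuExt, rot_zero, h0]
  have hleft : ∀ s, 1 ≤ s → s ≤ m + 1 → b (piExt π s - 1) = rot (nuExt nu s) * a (s - 1) := by
    intro s hs hsm
    by_cases h : 1 ≤ s ∧ s ≤ m
    · simp only [piExt, nuExt, dif_pos h, Nat.add_sub_cancel]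
      exact (hl ⟨s - 1, by omega⟩).symm
    · obtain rfl : s = m + 1 := by omega
      simp [piExt, nuExt, rot_zero, hm]
  have hstep : ∀ s ≤ m, rot (nuExt nu s) * a s =
      rot (nuExt nu (sigmaPi π s + 1)) * a (sigmaPi π s) := by
    intro s hs
    have h := hleft (sigmaPi π s + 1) (by omega) (Nat.succ_le_succ (sigmaPi_le hs))
    rw [sigmaPi_add_one, piExt_piExtInv, Nat.add_sub_cancel, ← sigmaPi_add_one,
      Nat.add_sub_cancel] at h
    rw [← hright s hs, h]
  have hmem : ∀ s ∈ orbitOf π i, s ≤ m := fun s hs =>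
    Finset.mem_Iic.1 (Finset.mem_filter.1 hs).1
  have hprod : (∏ s ∈ orbitOf π i, rot (nuExt nu s)) * ∏ s ∈ orbitOf π i, a s =
      (∏ s ∈ orbitOf π i, rot (nuExt nu (s + 1))) * ∏ s ∈ orbitOf π i, a s := by
    rw [← Finset.prod_mul_distrib, ← Finset.prod_mul_distrib,
      ← prod_comp_sigmaPi fun s => rot (nuExt nu (s + 1)) * a s]
    exact Finset.prod_congr rfl fun s hs => hstep s (hmem s hs)
  have hrot := mul_right_cancel₀ (Finset.prod_ne_zero_iff.2 fun s _ => ha s) hprod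
  rw [← rot_sum, ← rot_sum] at hrot
  have hsub : orbitOf π i ⊆ Finset.range (m + 1) := fun s hs =>
    Finset.mem_range.2 (Nat.lt_succ_of_le (hmem s hs))
  rw [sum_bvec_mul hsub]
  exact exists_int_of_rot_eq hrot.symm

end Orbits

section Conclusion

variable {m : ℕ} {lam nu : Fin m → ℝ} {π : Equiv.Perm (Fin m)} {f : ℝ → ℂ}

/-- The `s`-th endpoint of the partition. -/
def node (lam : Fin m → ℝ) (s : ℕ) : ℝ :=
  ∑ i ∈ Finset.univ.filter (fun i : Fin m => (i : ℕ) < s), lam i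

lemma node_val (lam : Fin m → ℝ) (j : Fin m) : node lam j = pre lam j := rfl

lemma node_val_succ (lam : Fin m → ℝ) (j : Fin m) : node lam (j + 1) = pre lam j + lam j := by
  rw [pre_add_self, node]
  refine Finset.sum_congr (Finset.filter_congr fun i _ => ?_) fun _ _ => rfl
  rw [Fin.le_def, Nat.lt_succ_iff]

lemma node_zero (lam : Fin m → ℝ) : node lam 0 = 0 := by simp [node]

lemma node_self (lam : Fin m → ℝ) : node lam m = ∑ i, lam i := by simp [node]

lemma norm_phiFn (hpos : ∀ j, 0 < lam j) {x : ℝ} (hx : x ∈ Ico 0 (∑ i, lam i)) :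
    ‖phiFn lam nu x‖ = 1 := by
  obtain ⟨j, hj⟩ := exists_mem_block hx
  rw [phiFn_of_mem hpos hj, ← rot, norm_rot]

lemma integral_norm_pos (hf : Measurable f) (hf1 : ∀ x, ‖f x‖ ≤ 1) {L : ℝ}
    (hL : 0 < L) (hfpos : 0 < volume {x ∈ Ico 0 L | f x ≠ 0}) : 0 < ∫ y in 0..L, ‖f y‖ := by
  have hi : IntervalIntegrable (fun y => ‖f y‖) volume 0 L := by
    simpa using intervalIntegrable_norm_sub hf hf1 (continuous_const (y := (0 : ℂ))) 0 L
  rw [intervalIntegral.integral_pos_iff_support_of_nonneg_ae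
    (Filter.Eventually.of_forall fun _ => norm_nonneg _) hi]
  refine ⟨hL, hfpos.trans_le ?_⟩
  refine measure_mono_ae ?_
  filter_upwards [(countable_singleton (0 : ℝ)).ae_notMem volume] with x hx0 hx
  have hx : x ∈ Ico 0 L ∧ f x ≠ 0 := hx
  have hne : (0 : ℝ) ≠ x := fun h => hx0 h.symm
  exact ⟨by simpa using hx.2, lt_of_le_of_ne hx.1.1 hne, hx.1.2.le⟩

/-- A nontrivial solution forces integrality when the discontinuities separate well. -/
lemma exists_int_of_farOrbits (hm : 2 ≤ m) (hirr : PermIrreducible π)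
    (hpos : ∀ j, 0 < lam j) {c : ℝ} (hc : 0 < c)
    (hfar : ∃ᶠ M : ℕ in Filter.atTop, FarOrbits lam π M (c / (M + 1)))
    (hf : Measurable f) (hfpos : 0 < volume {x ∈ Ico 0 (∑ i, lam i) | f x ≠ 0})
    (heq : ∀ᵐ x, x ∈ Ico 0 (∑ i, lam i) → f (iet lam π x) = phiFn lam nu x * f x)
    {S : Finset ℕ} (hS : S ∈ orbitsOf π) :
    ∃ z : ℤ, ∑ i : Fin m, (bvec S i : ℝ) * nu i = (z : ℝ) := by
  have hL : 0 < ∑ i, lam i :=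
    Finset.sum_pos (fun i _ => hpos i) ⟨⟨0, by omega⟩, Finset.mem_univ _⟩
  set g : ℝ → ℂ := fun x => f x / (‖f x‖ : ℂ) with hg
  have hgm : Measurable g := hf.div (Complex.measurable_ofReal.comp hf.norm)
  have hg1 : ∀ x, ‖g x‖ = 0 ∨ ‖g x‖ = 1 := by
    intro x
    have hgn : ‖g x‖ = ‖f x‖ / ‖f x‖ := by
      simp only [hg, norm_div, Complex.norm_real, norm_norm]
    rcases eq_or_ne ‖f x‖ 0 with h | h
    · left
      rw [hgn, h, div_zero]
    · right
      rw [hgn, div_self h]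
  have hg1' : ∀ x, ‖g x‖ ≤ 1 := fun x => by rcases hg1 x with h | h <;> norm_num [h]
  have hg0 : ∀ x, g x ≠ 0 ↔ f x ≠ 0 := fun x => by simp [hg]
  have hgeq : ∀ᵐ x, x ∈ Ico 0 (∑ i, lam i) → g (iet lam π x) = phiFn lam nu x * g x := by
    filter_upwards [heq] with x hx hxI
    simp only [hg]
    rw [hx hxI, norm_mul, norm_phiFn hpos hxI, one_mul, mul_div_assoc]
  have hP := integral_norm_pos hgm hg1' hL (by simpa only [hg0] using hfpos)
  obtain ⟨A, hA, hAj⟩ := exists_boundary_values hm hirr hpos hc hfar hgm hg1 hP hgeq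
  refine exists_int_of_boundary_values (a := fun s => A (node lam s))
    (b := fun s => A (node (permLam lam π) s))
    (fun s => norm_ne_zero_iff.1 (by rw [hA]; exact one_ne_zero)) ?_ ?_ ?_ ?_ hS
  · simp only [node_zero]
  · simp only [node_self, sum_permLam]
  · intro j
    simp only [node_val]
    exact (hAj j).1
  · intro j
    simp only [node_val_succ]
    exact (hAj j).2

/-- The case of a single interval. -/
lemma exists_int_of_one {lam nu : Fin 1 → ℝ} {π : Equiv.Perm (Fin 1)} (hpos : ∀ j, 0 < lam j)
    (hfpos : 0 < volume {x ∈ Ico 0 (∑ i, lam i) | f x ≠ 0})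
    (heq : ∀ᵐ x, x ∈ Ico 0 (∑ i, lam i) → f (iet lam π x) = phiFn lam nu x * f x)
    {S : Finset ℕ} (hS : S ∈ orbitsOf π) :
    ∃ z : ℤ, ∑ i : Fin 1, (bvec S i : ℝ) * nu i = (z : ℝ) := by
  obtain ⟨x, ⟨hx, hfx⟩, hxeq⟩ :=
    ((frequently_ae_mem_iff.2 hfpos.ne').and_eventually heq).exists
  obtain ⟨j, hj⟩ := exists_mem_block hx
  have hw : wvec lam π j = 0 := by
    simp [wvec, pre, Subsingleton.elim _ j]
  have h := hxeq hx
  rw [iet_of_mem hpos hj, phiFn_of_mem hpos hj, hw, add_zero, ← rot] at h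
  have hrot : rot (nu j) = 1 := (mul_eq_right₀ hfx).1 h.symm
  have hall : ∀ i : Fin 1, rot (nu i) * 1 = 1 := fun i => by
    rw [Subsingleton.elim i j, hrot, mul_one]
  exact exists_int_of_boundary_values (a := fun _ => 1) (b := fun _ => 1)
    (fun _ => one_ne_zero) rfl rfl hall hall hS

end Conclusion

/-- Veech's weak mixing theorem: for irreducible `π` and Lebesgue-a.e.
`λ ∈ ℝ₊^m`, for every `ν ∈ ℝ^m`: if the equation `f(T_{(λ,π)}x) = φ_{(λ,ν)}(x) f(x)`
(a.e. on `[0,|λ|)`) admits a measurable solution that is nonzero on a set of positive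
measure, then `b_S · ν ∈ ℤ` for every orbit `S ∈ Σ(π)`. -/
theorem stmt6 (m : ℕ) (hm : 1 ≤ m) (π : Equiv.Perm (Fin m))
    (hirr : PermIrreducible π) :
    ∀ᵐ lam ∂(volume : Measure (Fin m → ℝ)), (∀ j, 0 < lam j) →
      ∀ nu : Fin m → ℝ,
        (∃ f : ℝ → ℂ, Measurable f ∧
          0 < volume {x ∈ Set.Ico (0 : ℝ) (∑ i, lam i) | f x ≠ 0} ∧
          ∀ᵐ x ∂(volume : Measure ℝ), x ∈ Set.Ico (0 : ℝ) (∑ i, lam i) →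
            f (iet lam π x) = phiFn lam nu x * f x) →
        ∀ S ∈ orbitsOf π, ∃ z : ℤ, ∑ i : Fin m, (bvec S i : ℝ) * nu i = (z : ℝ) := by
  rcases Nat.eq_or_lt_of_le hm with rfl | hm2
  · refine Filter.Eventually.of_forall fun lam hpos nu hsol S hS => ?_
    obtain ⟨f, -, hfpos, heq⟩ := hsol
    exact exists_int_of_one hpos hfpos heq hS
  · filter_upwards [ae_frequently_farOrbits hirr] with lam hlam hpos nu hsol S hS
    obtain ⟨f, hf, hfpos, heq⟩ := hsol
    obtain ⟨c, hc, hfar⟩ := hlam hpos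
    exact exists_int_of_farOrbits hm2 hirr hpos hc hfar hf hfpos heq hS
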